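/- arXiv:math/9209215 — 3 statements merged into one kernel-verified Lean document; each statement's English description precedes it below -/
import Mathlib

section
/- Let 2 < p < ∞, let N ≥ n ≥ 2, let τ be a probability measure on N̄ = {1,…,N}, and let X be an n-dimensional subspace of L_p(N̄, τ). Then there exist an integer M with N ≤ M ≤ (3/2)N, a probability measure ν on M̄ = {1,…,M}, a partition {σ_1,…,σ_N} of M̄ with Σ_{i∈σ_j} ν{i} = τ{j} for each j, and a partition M̄ = M_1 ∪ M_2 into two sets each of cardinality at most (7/8)N, such that, with Y = J_p X, for every y ∈ Y and j = 1, 2: ‖1_{M_j} y‖_{L_p(M̄,ν)}^p ≤ (1/2 + C_p (n^{p/2}/N)^{1/2} (log n) (log N)^{1/2}) ‖y‖_{L_p(M̄,ν)}^p, where C_p is a constant depending only on p (of the form C p^2 2^{p/2} with C absolute). -/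
open scoped BigOperators

/-- Hoeffding's inequality for finitely many Rademacher sums, in existential form. -/
theorem exists_signs_abs_sum_le {ι α : Type*} [Fintype ι] (s : Finset α) (a : α → ι → ℝ)
    (v R : α → ℝ) (hv : ∀ k ∈ s, 0 < v k) (hR : ∀ k ∈ s, 0 ≤ R k)
    (hav : ∀ k ∈ s, ∑ i, a k i ^ 2 ≤ v k)
    (hsum : ∑ k ∈ s, 2 * Real.exp (-(R k ^ 2 / (2 * v k))) < 1) :
    ∃ ε : ι → ℝ, (∀ i, ε i = 1 ∨ ε i = -1) ∧ ∀ k ∈ s, |∑ i, ε i * a k i| ≤ R k := by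
  classical
  let sg : Bool → ℝ := fun b => if b then 1 else -1
  by_contra hcon
  push Not at hcon
  have hbad : ∀ e : ι → Bool, ∃ k ∈ s, R k < |∑ i, sg (e i) * a k i| := fun e =>
    hcon (fun i => sg (e i)) (fun i => by dsimp [sg]; split_ifs <;> simp)
  have hmgf : ∀ (b : ι → ℝ),
      ∑ e : ι → Bool, Real.exp (∑ i, sg (e i) * b i) ≤
        2 ^ Fintype.card ι * Real.exp ((∑ i, b i ^ 2) / 2) := by
    intro b
    have h1 : ∑ e : ι → Bool, Real.exp (∑ i, sg (e i) * b i) = ∏ i, (2 * Real.cosh (b i)) := by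
      have h2 := Finset.prod_univ_sum (fun _ : ι => (Finset.univ : Finset Bool))
        (fun i c => Real.exp (sg c * b i))
      rw [Fintype.piFinset_univ] at h2
      simp_rw [Real.exp_sum]
      rw [← h2]
      refine Finset.prod_congr rfl fun i _ => ?_
      simp [sg, Real.cosh_eq]
      ring
    rw [h1, Finset.prod_mul_distrib, Finset.prod_const, Finset.card_univ, Finset.sum_div,
      Real.exp_sum]
    gcongr with i
    exact Real.cosh_le_exp_half_sq _
  let l : α → ℝ := fun k => R k / v k
  let F : α → (ι → Bool) → ℝ := fun k e =>
    Real.exp (-(l k * R k)) * (Real.exp (∑ i, sg (e i) * (l k * a k i)) +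
      Real.exp (∑ i, sg (e i) * (-(l k) * a k i)))
  have hlow : ∀ e, 1 ≤ ∑ k ∈ s, F k e := by
    intro e
    obtain ⟨k, hk, hlt⟩ := hbad e
    have hl : 0 ≤ l k := div_nonneg (hR k hk) (hv k hk).le
    refine le_trans ?_ (Finset.single_le_sum (f := fun k => F k e)
      (fun j _ => by positivity) hk)
    have e1 : ∑ i, sg (e i) * (l k * a k i) = l k * ∑ i, sg (e i) * a k i := by
      rw [Finset.mul_sum]; exact Finset.sum_congr rfl fun _ _ => by ring
    have e2 : ∑ i, sg (e i) * (-(l k) * a k i) = -(l k * ∑ i, sg (e i) * a k i) := by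
      rw [Finset.mul_sum, ← Finset.sum_neg_distrib]
      exact Finset.sum_congr rfl fun _ _ => by ring
    simp only [F, e1, e2, mul_add, ← Real.exp_add]
    rcases lt_abs.mp hlt with h | h
    · have : 1 ≤ Real.exp (-(l k * R k) + l k * ∑ i, sg (e i) * a k i) :=
        Real.one_le_exp (by nlinarith)
      have := Real.exp_pos (-(l k * R k) + -(l k * ∑ i, sg (e i) * a k i))
      linarith
    · have : 1 ≤ Real.exp (-(l k * R k) + -(l k * ∑ i, sg (e i) * a k i)) :=
        Real.one_le_exp (by nlinarith)
      have := Real.exp_pos (-(l k * R k) + l k * ∑ i, sg (e i) * a k i)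
      linarith
  have hup : ∀ k ∈ s, ∑ e, F k e ≤
      2 ^ Fintype.card ι * (2 * Real.exp (-(R k ^ 2 / (2 * v k)))) := by
    intro k hk
    have hvk := hv k hk
    have hsq : (∑ i, (l k * a k i) ^ 2) / 2 ≤ R k ^ 2 / (2 * v k) := by
      have : ∑ i, (l k * a k i) ^ 2 = l k ^ 2 * ∑ i, a k i ^ 2 := by
        rw [Finset.mul_sum]; exact Finset.sum_congr rfl fun _ _ => by ring
      rw [this]
      calc l k ^ 2 * (∑ i, a k i ^ 2) / 2 ≤ l k ^ 2 * v k / 2 := by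
            gcongr; exact hav k hk
        _ = _ := by simp only [l]; field_simp
    have hlR : l k * R k = 2 * (R k ^ 2 / (2 * v k)) := by simp only [l]; field_simp
    have h1 := hmgf fun i => l k * a k i
    have h2 := hmgf fun i => -(l k) * a k i
    have h3 : ∑ i, (-(l k) * a k i) ^ 2 = ∑ i, (l k * a k i) ^ 2 :=
      Finset.sum_congr rfl fun _ _ => by ring
    rw [h3] at h2
    have h4 := Real.exp_le_exp.mpr hsq
    simp only [F, ← Finset.mul_sum, Finset.sum_add_distrib]
    calc _ ≤ Real.exp (-(l k * R k)) * (2 ^ Fintype.card ι * Real.exp (R k ^ 2 / (2 * v k)) +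
          2 ^ Fintype.card ι * Real.exp (R k ^ 2 / (2 * v k))) := by
          gcongr
          · exact h1.trans (by gcongr)
          · exact h2.trans (by gcongr)
      _ = 2 ^ Fintype.card ι * (2 * (Real.exp (-(l k * R k)) * Real.exp (R k ^ 2 / (2 * v k)))) := by
          ring
      _ = _ := by rw [← Real.exp_add, hlR]; ring_nf
  have hcard : (2 : ℝ) ^ Fintype.card ι = ∑ _e : ι → Bool, (1 : ℝ) := by simp
  have : (2 : ℝ) ^ Fintype.card ι < 2 ^ Fintype.card ι * 1 := by
    calc (2 : ℝ) ^ Fintype.card ι = ∑ _e : ι → Bool, (1 : ℝ) := hcard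
      _ ≤ ∑ e, ∑ k ∈ s, F k e := Finset.sum_le_sum fun e _ => hlow e
      _ = ∑ k ∈ s, ∑ e, F k e := Finset.sum_comm
      _ ≤ ∑ k ∈ s, 2 ^ Fintype.card ι * (2 * Real.exp (-(R k ^ 2 / (2 * v k)))) :=
          Finset.sum_le_sum hup
      _ = 2 ^ Fintype.card ι * ∑ k ∈ s, (2 * Real.exp (-(R k ^ 2 / (2 * v k)))) := by
          rw [Finset.mul_sum]
      _ < _ := by gcongr
  linarith

theorem exp_inner_mul_gaussianWeight {E : Type*} [NormedAddCommGroup E] [InnerProductSpace ℝ E]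
    (v y : E) :
    Real.exp (inner ℝ v y) * Real.exp (-(1 / 2) * ‖y‖ ^ 2) =
      Real.exp (‖v‖ ^ 2 / 2) * Real.exp (-(1 / 2) * ‖y - v‖ ^ 2) := by
  rw [← Real.exp_add, ← Real.exp_add, norm_sub_sq_real, real_inner_comm v y]
  ring_nf

section GaussianEntropy

open MeasureTheory

variable {E : Type*} [NormedAddCommGroup E] [InnerProductSpace ℝ E] [FiniteDimensional ℝ E]
  [MeasurableSpace E] [BorelSpace E]

theorem integral_gaussianWeight_pos : 0 < ∫ y : E, Real.exp (-(1 / 2) * ‖y‖ ^ 2) := by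
  rw [GaussianFourier.integral_rexp_neg_mul_sq_norm (by norm_num)]
  positivity

theorem integrable_gaussianWeight : Integrable fun y : E => Real.exp (-(1 / 2) * ‖y‖ ^ 2) :=
  Integrable.of_integral_ne_zero integral_gaussianWeight_pos.ne'

theorem integrable_exp_inner_mul_gaussianWeight (v : E) :
    Integrable fun y : E => Real.exp (inner ℝ v y) * Real.exp (-(1 / 2) * ‖y‖ ^ 2) := by
  simp_rw [exp_inner_mul_gaussianWeight]
  exact (integrable_gaussianWeight.comp_sub_right v).const_mul _

theorem integral_exp_inner_mul_gaussianWeight (v : E) :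
    ∫ y : E, Real.exp (inner ℝ v y) * Real.exp (-(1 / 2) * ‖y‖ ^ 2) =
      Real.exp (‖v‖ ^ 2 / 2) * ∫ y : E, Real.exp (-(1 / 2) * ‖y‖ ^ 2) := by
  simp_rw [exp_inner_mul_gaussianWeight]
  rw [integral_const_mul, integral_sub_right_eq_self (fun y : E => Real.exp (-(1 / 2) * ‖y‖ ^ 2)) v]

/-- A symmetric set keeps at least the fraction `exp (-‖v‖² / 2)` of its Gaussian mass when
translated by `v`. -/
theorem gaussianWeight_translate_ge {K : Set E} (hK : MeasurableSet K)
    (hsymm : ∀ y, -y ∈ K ↔ y ∈ K) (v : E) :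
    Real.exp (-(‖v‖ ^ 2 / 2)) * ∫ y : E, K.indicator 1 y * Real.exp (-(1 / 2) * ‖y‖ ^ 2) ≤
      ∫ y : E, K.indicator 1 (y - v) * Real.exp (-(1 / 2) * ‖y‖ ^ 2) := by
  let g : E → ℝ := fun y => Real.exp (-(1 / 2) * ‖y‖ ^ 2)
  let k : E → ℝ := K.indicator 1
  have hg : Integrable g := integrable_gaussianWeight
  have hk : ∀ y, k (-y) = k y := fun y => by
    by_cases hy : y ∈ K <;> simp [k, hsymm, hy]
  have hint : ∀ h : E → ℝ, Integrable h → Integrable fun y => k y * h y := fun h hh => by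
    have : (fun y => k y * h y) = K.indicator h := by
      ext y; by_cases hy : y ∈ K <;> simp [k, hy]
    rw [this]; exact hh.indicator hK
  have e1 : ∫ y, k (y - v) * g y = ∫ y, k y * g (y + v) := by
    rw [← integral_add_right_eq_self (fun y => k (y - v) * g y) v]
    simp
  have e2 : ∫ y, k y * g (y + v) = ∫ y, k y * g (y - v) := by
    rw [← integral_neg_eq_self (fun y => k y * g (y + v)) volume]
    refine integral_congr_ae (.of_forall fun y => ?_)
    simp only [hk, g]
    rw [← norm_neg (-y + v)]
    rw [neg_add, neg_neg, ← sub_eq_add_neg]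
  have hpt : ∀ y, 2 * (Real.exp (-(‖v‖ ^ 2 / 2)) * (k y * g y)) ≤
      k y * g (y + v) + k y * g (y - v) := by
    intro y
    have hk0 : 0 ≤ k y := Set.indicator_nonneg (fun _ _ => zero_le_one) _
    have hpar : Real.exp (-(‖v‖ ^ 2 / 2)) ^ 2 * g y ^ 2 = g (y + v) * g (y - v) := by
      simp only [g, ← Real.exp_nat_mul, ← Real.exp_add, norm_add_sq_real, norm_sub_sq_real]
      congr 1; push_cast; ring
    have h3 : 2 * (Real.exp (-(‖v‖ ^ 2 / 2)) * g y) ≤ g (y + v) + g (y - v) := by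
      have p1 : 0 < g (y + v) := Real.exp_pos _
      have p2 : 0 < g (y - v) := Real.exp_pos _
      refine abs_le_of_sq_le_sq' ?_ (by positivity) |>.2
      nlinarith [sq_nonneg (g (y + v) - g (y - v))]
    nlinarith
  have h4 : ∫ y, 2 * (Real.exp (-(‖v‖ ^ 2 / 2)) * (k y * g y)) ≤
      ∫ y, (k y * g (y + v) + k y * g (y - v)) :=
    integral_mono (((hint g hg).const_mul _).const_mul _)
      ((hint _ (hg.comp_add_right v)).add (hint _ (hg.comp_sub_right v))) hpt
  rw [integral_const_mul, integral_const_mul, integral_add (hint _ (hg.comp_add_right v))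
    (hint _ (hg.comp_sub_right v)), ← e2] at h4
  change _ * ∫ y, k y * g y ≤ ∫ y, k (y - v) * g y
  rw [e1]
  linarith

/-- At least half of the Gaussian mass lies in the intersection of `m` slabs. -/
theorem gaussianWeight_slabs_ge {ι : Type*} [Fintype ι] [Nonempty ι] (φ : ι → E) {B : ℝ}
    (hB : 0 < B) (hφ : ∀ i, ‖φ i‖ ^ 2 ≤ B) :
    (∫ y : E, Real.exp (-(1 / 2) * ‖y‖ ^ 2)) / 2 ≤
      ∫ y : E, {y | ∀ i, |inner ℝ (φ i) y| ≤
        Real.sqrt (2 * B * Real.log (4 * Fintype.card ι))}.indicator 1 y *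
          Real.exp (-(1 / 2) * ‖y‖ ^ 2) := by
  set m : ℝ := (Fintype.card ι : ℝ) with hm
  set a := Real.sqrt (2 * B * Real.log (4 * m)) with ha
  set K : Set E := {y | ∀ i, |inner ℝ (φ i) y| ≤ a} with hKdef
  have hm1 : (1 : ℝ) ≤ m := by rw [hm]; exact_mod_cast Fintype.card_pos
  have hlog : 0 ≤ Real.log (4 * m) := Real.log_nonneg (by linarith)
  have ha2 : a ^ 2 = 2 * B * Real.log (4 * m) := Real.sq_sqrt (by positivity)
  have ha0 : 0 ≤ a := Real.sqrt_nonneg _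
  let g : E → ℝ := fun y => Real.exp (-(1 / 2) * ‖y‖ ^ 2)
  have hg : Integrable g := integrable_gaussianWeight
  have hK : MeasurableSet K := by
    have : IsClosed K := by
      simp only [hKdef, Set.ofPred_forall]
      exact isClosed_iInter fun i => isClosed_le (by fun_prop) (by fun_prop)
    exact this.measurableSet
  have hKint : Integrable fun y => K.indicator 1 y * g y := by
    have : (fun y => K.indicator 1 y * g y) = K.indicator g := by
      ext y; by_cases hy : y ∈ K <;> simp [hy]
    rw [this]; exact hg.indicator hK
  let s := a / B
  let h : ι → E → ℝ := fun i y => Real.exp (-(a * s)) *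
    (Real.exp (inner ℝ (s • φ i) y) * g y + Real.exp (inner ℝ (-(s • φ i)) y) * g y)
  have hh : ∀ i, Integrable (h i) := fun i =>
    ((integrable_exp_inner_mul_gaussianWeight _).add
      (integrable_exp_inner_mul_gaussianWeight _)).const_mul _
  have hpt : ∀ y, g y ≤ K.indicator 1 y * g y + ∑ i, h i y := by
    intro y
    have hgy : 0 < g y := Real.exp_pos _
    have hh0 : ∀ i, 0 ≤ h i y := fun i => by dsimp only [h]; positivity
    by_cases hy : y ∈ K
    · simp only [hy, Set.indicator_of_mem, Pi.one_apply, one_mul]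
      have := Finset.sum_nonneg fun i (_ : i ∈ Finset.univ) => hh0 i
      linarith
    · simp only [hy, not_false_eq_true, Set.indicator_of_notMem, zero_mul, zero_add]
      simp only [hKdef, Set.mem_ofPred_eq, not_forall, not_le] at hy
      obtain ⟨i, hi⟩ := hy
      refine le_trans ?_ (Finset.single_le_sum (f := fun i => h i y) (fun i _ => hh0 i)
        (Finset.mem_univ i))
      have hs : 0 ≤ s := by positivity
      have : 1 ≤ Real.exp (-(a * s)) * (Real.exp (inner ℝ (s • φ i) y) +
          Real.exp (inner ℝ (-(s • φ i)) y)) := by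
        rw [mul_add, ← Real.exp_add, ← Real.exp_add, inner_neg_left, real_inner_smul_left]
        rcases lt_abs.mp hi with h' | h'
        · have := Real.one_le_exp (x := -(a * s) + s * inner ℝ (φ i) y) (by nlinarith)
          have := Real.exp_pos (-(a * s) + -(s * inner ℝ (φ i) y))
          linarith
        · have := Real.one_le_exp (x := -(a * s) + -(s * inner ℝ (φ i) y)) (by nlinarith)
          have := Real.exp_pos (-(a * s) + s * inner ℝ (φ i) y)
          linarith
      dsimp only [h]
      nlinarith
  have hhi : ∀ i, ∫ y, h i y ≤ (∫ y, g y) / (2 * m) := by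
    intro i
    have hZ : 0 < ∫ y, g y := integral_gaussianWeight_pos
    dsimp only [h]
    rw [integral_const_mul, integral_add (integrable_exp_inner_mul_gaussianWeight _)
      (integrable_exp_inner_mul_gaussianWeight _), integral_exp_inner_mul_gaussianWeight,
      integral_exp_inner_mul_gaussianWeight, norm_neg, norm_smul]
    have hexp : Real.exp (-(a * s)) * Real.exp ((‖s‖ * ‖φ i‖) ^ 2 / 2) ≤ (4 * m)⁻¹ := by
      rw [← Real.exp_add, ← Real.exp_log (show 0 < (4 * m)⁻¹ by positivity), Real.exp_le_exp,
        Real.log_inv, mul_pow, Real.norm_eq_abs, sq_abs]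
      have h1 : s ^ 2 * ‖φ i‖ ^ 2 ≤ s ^ 2 * B := by gcongr; exact hφ i
      have h2 : s ^ 2 * B = 2 * Real.log (4 * m) := by
        simp only [s, div_pow, ha2]; field_simp
      have h3 : a * s = 2 * Real.log (4 * m) := by
        have : a * s = a ^ 2 / B := by simp only [s]; ring
        rw [this, ha2]; field_simp
      linarith
    calc _ = 2 * (Real.exp (-(a * s)) * Real.exp ((‖s‖ * ‖φ i‖) ^ 2 / 2)) * ∫ y, g y := by
          simp only [g]; ring
      _ ≤ 2 * (4 * m)⁻¹ * ∫ y, g y := by gcongr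
      _ = _ := by field_simp; norm_num
  have := integral_mono hg (hKint.add (integrable_finsetSum _ fun i _ => hh i)) hpt
  simp only [Pi.add_apply] at this
  rw [integral_add hKint (integrable_finsetSum _ fun i _ => hh i),
    integral_finsetSum _ fun i _ => hh i] at this
  have h5 : ∑ i, ∫ y, h i y ≤ (∫ y, g y) / 2 := by
    calc _ ≤ ∑ _i : ι, (∫ y, g y) / (2 * m) := Finset.sum_le_sum fun i _ => hhi i
      _ = _ := by
        rw [Finset.sum_const, Finset.card_univ, nsmul_eq_mul, ← hm]; field_simp
  change (∫ y, g y) / 2 ≤ ∫ y, K.indicator 1 y * g y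
  linarith

/-- Dual Sudakov inequality for a supremum of finitely many linear functionals: a bound on the
cardinality of separated subsets of the Euclidean unit ball. -/
theorem card_le_of_separated_of_gaussian {ι : Type*} [Fintype ι] [Nonempty ι] (φ : ι → E)
    {B t : ℝ} (hB : 0 < B) (ht : 0 < t) (hφ : ∀ i, ‖φ i‖ ^ 2 ≤ B) (S : Finset E)
    (hS : ∀ x ∈ S, ‖x‖ ≤ 1)
    (hsep : ∀ x ∈ S, ∀ y ∈ S, (∀ i, |inner ℝ (φ i) (x - y)| ≤ t) → x = y) :
    (S.card : ℝ) ≤ 2 * Real.exp (4 * B * Real.log (4 * Fintype.card ι) / t ^ 2) := by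
  set m : ℝ := (Fintype.card ι : ℝ) with hm
  set a := Real.sqrt (2 * B * Real.log (4 * m)) with ha
  set K : Set E := {y | ∀ i, |inner ℝ (φ i) y| ≤ a} with hKdef
  have hm1 : (1 : ℝ) ≤ m := by rw [hm]; exact_mod_cast Fintype.card_pos
  have hlog : 0 < Real.log (4 * m) := Real.log_pos (by linarith)
  have ha2 : a ^ 2 = 2 * B * Real.log (4 * m) := Real.sq_sqrt (by positivity)
  have ha0 : 0 < a := Real.sqrt_pos.mpr (by positivity)
  let g : E → ℝ := fun y => Real.exp (-(1 / 2) * ‖y‖ ^ 2)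
  have hg : Integrable g := integrable_gaussianWeight
  have hK : MeasurableSet K := by
    have : IsClosed K := by
      simp only [hKdef, Set.ofPred_forall]
      exact isClosed_iInter fun i => isClosed_le (by fun_prop) (by fun_prop)
    exact this.measurableSet
  have hsymm : ∀ y, -y ∈ K ↔ y ∈ K := fun y => by simp [hKdef]
  let l := 2 * a / t
  have hl : 0 < l := by positivity
  have hint : ∀ x : E, Integrable fun y => K.indicator 1 (y - l • x) * g y := fun x => by
    have : (fun y => K.indicator 1 (y - l • x) * g y) =
        ((fun y => y - l • x) ⁻¹' K).indicator g := by
      ext y; by_cases hy : y - l • x ∈ K <;> simp [hy]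
    rw [this]; exact hg.indicator (hK.preimage (by fun_prop))
  have hdisj : ∀ y, ∑ x ∈ S, K.indicator (1 : E → ℝ) (y - l • x) ≤ 1 := by
    intro y
    by_cases hex : ∃ x ∈ S, y - l • x ∈ K
    · obtain ⟨x, hx, hxK⟩ := hex
      rw [Finset.sum_eq_single_of_mem x hx]
      · simp [hxK]
      · intro z hz hzx
        refine Set.indicator_of_notMem (fun hzK => hzx ?_) _
        refine hsep z hz x hx fun i => ?_
        have h1 := hxK i
        have h2 := hzK i
        have h3 : l * inner ℝ (φ i) (z - x) =
            inner ℝ (φ i) (y - l • x) - inner ℝ (φ i) (y - l • z) := by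
          simp only [inner_sub_right, real_inner_smul_right]; ring
        have h4 : l * |inner ℝ (φ i) (z - x)| ≤ 2 * a := by
          rw [← abs_of_pos hl, ← abs_mul, h3]
          exact (abs_sub _ _).trans (by linarith)
        have h5 : l * t = 2 * a := by simp only [l]; field_simp
        rw [← h5] at h4
        exact le_of_mul_le_mul_left h4 hl
    · push Not at hex
      rw [Finset.sum_eq_zero fun x hx => Set.indicator_of_notMem (hex x hx) _]
      exact zero_le_one
  have hZ : 0 < ∫ y, g y := integral_gaussianWeight_pos
  have hup : ∑ x ∈ S, ∫ y, K.indicator 1 (y - l • x) * g y ≤ ∫ y, g y := by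
    rw [← integral_finsetSum _ fun x _ => hint x]
    refine integral_mono (integrable_finsetSum _ fun x _ => hint x) hg fun y => ?_
    simp only [← Finset.sum_mul]
    exact mul_le_of_le_one_left (Real.exp_pos _).le (hdisj y)
  have hlow : ∀ x ∈ S, Real.exp (-(l ^ 2 / 2)) * ((∫ y, g y) / 2) ≤
      ∫ y, K.indicator 1 (y - l • x) * g y := by
    intro x hx
    refine le_trans ?_ (gaussianWeight_translate_ge hK hsymm (l • x))
    gcongr ?_ * ?_
    · rw [Real.exp_le_exp, norm_smul, mul_pow, Real.norm_eq_abs, sq_abs]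
      have : ‖x‖ ^ 2 ≤ 1 := by nlinarith [hS x hx, norm_nonneg x]
      nlinarith [sq_nonneg l]
    · exact gaussianWeight_slabs_ge φ hB hφ
  have h6 := (Finset.sum_le_sum hlow).trans hup
  rw [Finset.sum_const, nsmul_eq_mul] at h6
  have h7 : l ^ 2 / 2 = 4 * B * Real.log (4 * m) / t ^ 2 := by
    simp only [l, div_pow, mul_pow, ha2]; ring
  rw [← h7]
  have h8 : Real.exp (-(l ^ 2 / 2)) * Real.exp (l ^ 2 / 2) = 1 := by
    rw [← Real.exp_add]; simp
  have h9 : (S.card : ℝ) * Real.exp (-(l ^ 2 / 2)) ≤ 2 := by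
    refine le_of_mul_le_mul_right (a := (∫ y, g y) / 2) ?_ (by positivity)
    linarith
  calc (S.card : ℝ) = S.card * Real.exp (-(l ^ 2 / 2)) * Real.exp (l ^ 2 / 2) := by
        rw [mul_assoc, h8, mul_one]
    _ ≤ _ := by gcongr

end GaussianEntropy

/-- Cardinality of separated subsets of the Euclidean unit ball, by counting cells of a grid. -/
theorem card_le_of_separated_of_grid {ι : Type*} {d : ℕ} (φ : ι → EuclideanSpace ℝ (Fin d))
    {B t : ℝ} (ht : 0 ≤ t) (hφ : ∀ i, ‖φ i‖ ^ 2 ≤ B) (Q : ℕ) (hQ : 0 < Q)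
    (hBQ : B * d ≤ (t * Q) ^ 2) (S : Finset (EuclideanSpace ℝ (Fin d)))
    (hS : ∀ x ∈ S, ‖x‖ ≤ 1)
    (hsep : ∀ x ∈ S, ∀ y ∈ S, (∀ i, |inner ℝ (φ i) (x - y)| ≤ t) → x = y) :
    S.card ≤ (2 * Q + 1) ^ d := by
  classical
  have hQ' : (0 : ℝ) < Q := by exact_mod_cast hQ
  let F : EuclideanSpace ℝ (Fin d) → (Fin d → ℤ) := fun x k => ⌊x k * Q⌋
  let G : Finset (Fin d → ℤ) := Fintype.piFinset fun _ => Finset.Icc (-(Q : ℤ)) Q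
  have hG : G.card = (2 * Q + 1) ^ d := by
    simp only [G, Fintype.card_piFinset, Int.card_Icc, Finset.prod_const, Finset.card_univ,
      Fintype.card_fin]
    congr 1; omega
  rw [← hG]
  refine Finset.card_le_card_of_injOn F (fun x hx => ?_) fun x hx y hy hxy => ?_
  · simp only [G, Finset.mem_coe, Fintype.mem_piFinset, Finset.mem_Icc]
    intro k
    have h1 : |x k| ≤ 1 := by
      have := PiLp.norm_apply_le x k
      rw [Real.norm_eq_abs] at this
      exact this.trans (hS x hx)
    obtain ⟨h2, h3⟩ := abs_le.mp h1
    constructor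
    · refine Int.le_floor.mpr ?_
      push_cast; nlinarith
    · have : (⌊x k * Q⌋ : ℝ) ≤ Q := (Int.floor_le _).trans (by nlinarith)
      exact_mod_cast this
  · refine hsep x hx y hy fun i => ?_
    have hcoord : ∀ k, ((x - y) k) ^ 2 ≤ (1 / Q : ℝ) ^ 2 := by
      intro k
      have h1 : |x k * Q - y k * Q| < 1 := Int.abs_sub_lt_one_of_floor_eq_floor (congrFun hxy k)
      have h2 : |(x - y) k| ≤ 1 / Q := by
        have h3 : |(x - y) k| * Q = |x k * Q - y k * Q| := by
          rw [← sub_mul, abs_mul, abs_of_pos hQ', PiLp.sub_apply]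
        rw [le_div_iff₀ hQ', h3]
        exact h1.le
      rw [← sq_abs]
      gcongr
    have hnorm : ‖x - y‖ ^ 2 ≤ d * (1 / Q : ℝ) ^ 2 := by
      rw [EuclideanSpace.real_norm_sq_eq]
      refine (Finset.sum_le_sum fun k _ => hcoord k).trans ?_
      simp
    have hcs := abs_real_inner_le_norm (φ i) (x - y)
    refine hcs.trans ?_
    refine abs_le_of_sq_le_sq' ?_ ht |>.2
    rw [mul_pow]
    calc ‖φ i‖ ^ 2 * ‖x - y‖ ^ 2 ≤ B * (d * (1 / Q : ℝ) ^ 2) := by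
          gcongr
          · exact (sq_nonneg _).trans (hφ i)
          · exact hφ i
      _ = (B * d) / (Q : ℝ) ^ 2 := by field_simp
      _ ≤ (t * Q) ^ 2 / (Q : ℝ) ^ 2 := by gcongr
      _ = t ^ 2 := by field_simp

/-- A bound on the cardinality of separated sets yields a finite net of that cardinality. -/
theorem exists_net_of_separated_card_le {E : Type*} (near : E → E → Prop) (hrefl : ∀ x, near x x)
    (hsymm : ∀ x y, near x y → near y x) (T : Set E) (m : ℝ)
    (hcard : ∀ S : Finset E, ↑S ⊆ T → (∀ x ∈ S, ∀ y ∈ S, near x y → x = y) → (S.card : ℝ) ≤ m) :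
    ∃ S : Finset E, ↑S ⊆ T ∧ (S.card : ℝ) ≤ m ∧ ∀ x ∈ T, ∃ y ∈ S, near x y := by
  classical
  let P : Set ℕ := {c | ∃ S : Finset E, ↑S ⊆ T ∧ (∀ x ∈ S, ∀ y ∈ S, near x y → x = y) ∧ S.card = c}
  have hne : P.Nonempty := ⟨0, ∅, by simp, by simp, by simp⟩
  have hbdd : BddAbove P := ⟨⌊m⌋₊, by
    rintro c ⟨S, hST, hS, rfl⟩
    exact Nat.le_floor (hcard S hST hS)⟩
  obtain ⟨S, hST, hS, hSc⟩ := Nat.sSup_mem hne hbdd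
  refine ⟨S, hST, hcard S hST hS, fun x hx => ?_⟩
  by_contra! hcon
  have hxS : x ∉ S := fun h => hcon x h (hrefl x)
  have hmem : (insert x S).card ∈ P := by
    refine ⟨insert x S, ?_, ?_, rfl⟩
    · rw [Finset.coe_insert]
      exact Set.insert_subset hx hST
    · intro y hy z hz hyz
      rcases Finset.mem_insert.mp hy with rfl | hyS <;>
        rcases Finset.mem_insert.mp hz with rfl | hzS
      · rfl
      · exact absurd hyz (hcon z hzS)
      · exact absurd (hsymm _ _ hyz) (hcon y hyS)
      · exact hS y hyS z hzS hyz
  have := le_csSup hbdd hmem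
  rw [Finset.card_insert_of_notMem hxS, hSc] at this
  omega

/-- A chaining bound for Rademacher processes: there is one choice of signs that is nearly balanced
and controls the whole process. -/
theorem exists_signs_chaining {ι E : Type*} [Fintype ι] [Nonempty ι] (near : ℕ → E → E → Prop)
    (hrefl : ∀ k x, near k x x) (hsymm : ∀ k x y, near k x y → near k y x) (T : Set E)
    (f : E → ι → ℝ) (K : ℕ) (m v : ℕ → ℝ) {R R₀ : ℝ} (hR : 0 ≤ R) (hR₀ : 0 ≤ R₀)
    (hv : ∀ k, 0 < v k)
    (hcard : ∀ k, 1 ≤ k → k ≤ K → ∀ S : Finset E, ↑S ⊆ T →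
      (∀ x ∈ S, ∀ y ∈ S, near k x y → x = y) → (S.card : ℝ) ≤ m k)
    (hvar : ∀ k ≤ K, ∀ x ∈ T, ∀ y ∈ T, near k x y → ∑ i, (f x i - f y i) ^ 2 ≤ v k)
    {x₀ : E} (hx₀ : x₀ ∈ T) (hf₀ : f x₀ = 0) (hnear : ∀ x ∈ T, near 0 x x₀)
    (hsum : 2 * Real.exp (-(R₀ ^ 2 / (2 * Fintype.card ι))) +
      ∑ k ∈ Finset.range K, m (k + 1) * (2 * Real.exp (-(R ^ 2 / (2 * v k)))) < 1) :
    ∃ ε : ι → ℝ, (∀ i, ε i = 1 ∨ ε i = -1) ∧ |∑ i, ε i| ≤ R₀ ∧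
      ∀ x ∈ T, |∑ i, ε i * f x i| ≤ K * R + Real.sqrt (Fintype.card ι * v K) := by
  classical
  have hM : (0 : ℝ) < Fintype.card ι := by exact_mod_cast Fintype.card_pos
  have hnet : ∀ k, ∃ S : Finset E, ↑S ⊆ T ∧ (k ≤ K → ∀ x ∈ T, ∃ y ∈ S, near k x y) ∧
      (1 ≤ k → k ≤ K → (S.card : ℝ) ≤ m k) ∧ (k = 0 → ∀ x ∈ S, f x = 0) := by
    intro k
    rcases Nat.eq_zero_or_pos k with rfl | hk
    · refine ⟨{x₀}, by simpa using hx₀, fun _ x hx => ⟨x₀, by simp, hnear x hx⟩, by simp, ?_⟩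
      simpa using hf₀
    by_cases hkK : k ≤ K
    · obtain ⟨S, h1, h2, h3⟩ := exists_net_of_separated_card_le (near k) (hrefl k) (hsymm k) T (m k)
        (hcard k hk hkK)
      exact ⟨S, h1, fun _ => h3, fun _ _ => h2, by omega⟩
    · exact ⟨∅, by simp, fun h => absurd h hkK, fun _ h => absurd h hkK, by omega⟩
  choose S hST hSnet hSm hS0 using hnet
  have hproj : ∀ k x, ∃ y, k ≤ K → x ∈ T → y ∈ S k ∧ near k x y := by
    intro k x
    by_cases h : k ≤ K ∧ x ∈ T
    · obtain ⟨y, hy⟩ := hSnet k h.1 x h.2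
      exact ⟨y, fun _ _ => hy⟩
    · exact ⟨x₀, fun h1 h2 => absurd ⟨h1, h2⟩ h⟩
  choose π hπ using hproj
  let s : Finset (Option (Σ _ : ℕ, E)) :=
    Finset.insertNone ((Finset.range K).sigma fun k => S (k + 1))
  let a : Option (Σ _ : ℕ, E) → ι → ℝ := fun o i =>
    o.elim 1 fun q => f q.2 i - f (π q.1 q.2) i
  let w : Option (Σ _ : ℕ, E) → ℝ := fun o => o.elim (Fintype.card ι : ℝ) fun q => v q.1
  let r : Option (Σ _ : ℕ, E) → ℝ := fun o => o.elim R₀ fun _ => R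
  obtain ⟨ε, hε, hεs⟩ := exists_signs_abs_sum_le s a w r
    (by rintro (_ | q) _; exacts [hM, hv _]) (by rintro (_ | q) _; exacts [hR₀, hR])
    (by
      rintro (_ | ⟨k, x⟩) hq
      · simp [a, w]
      · simp only [s, Finset.some_mem_insertNone, Finset.mem_sigma, Finset.mem_range] at hq
        have hxT := hST _ hq.2
        obtain ⟨h1, h2⟩ := hπ k x hq.1.le hxT
        exact hvar k hq.1.le x hxT _ (hST _ h1) h2)
    (by
      refine lt_of_le_of_lt ?_ hsum
      rw [Finset.sum_insertNone, Finset.sum_sigma]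
      refine add_le_add le_rfl (Finset.sum_le_sum fun k hk => ?_)
      rw [Finset.mem_range] at hk
      simp only [r, w, Option.elim_some, Finset.sum_const, nsmul_eq_mul]
      gcongr
      exact hSm (k + 1) (by omega) hk)
  refine ⟨ε, hε, by simpa [a, r] using hεs none (by simp [s]), ?_⟩
  have hlevel : ∀ k ≤ K, ∀ x ∈ S k, |∑ i, ε i * f x i| ≤ k * R := by
    intro k
    induction k with
    | zero => intro _ x hx; simp [hS0 0 rfl x hx]
    | succ k ih =>
      intro hk x hx
      obtain ⟨h1, _⟩ := hπ k x (by omega) (hST _ hx)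
      have h3 := ih (by omega) _ h1
      have h4 := hεs (some ⟨k, x⟩) (by simp [s, hx]; omega)
      simp only [a, r, Option.elim_some, mul_sub, Finset.sum_sub_distrib] at h4
      have h5 := abs_sub_abs_le_abs_sub (∑ i, ε i * f x i) (∑ i, ε i * f (π k x) i)
      push_cast
      linarith
  intro x hx
  obtain ⟨h1, h2⟩ := hπ K x le_rfl hx
  have h3 := hlevel K le_rfl _ h1
  have h4 := hvar K le_rfl x hx _ (hST _ h1) h2
  have h5 : |∑ i, ε i * (f x i - f (π K x) i)| ≤ Real.sqrt (Fintype.card ι * v K) := by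
    refine Real.abs_le_sqrt ((Finset.sum_mul_sq_le_sq_mul_sq _ _ _).trans ?_)
    have h6 : ∑ i, ε i ^ 2 = Fintype.card ι := by
      rw [Finset.sum_congr rfl fun i _ => show ε i ^ 2 = 1 by rcases hε i with h | h <;> simp [h]]
      simp
    rw [h6]
    gcongr
  simp only [mul_sub, Finset.sum_sub_distrib] at h5
  have h6 := abs_sub_abs_le_abs_sub (∑ i, ε i * f x i) (∑ i, ε i * f (π K x) i)
  linarith

theorem abs_rpow_sub_rpow_le {p a b : ℝ} (hp : 1 ≤ p) (ha : 0 ≤ a) (hb : 0 ≤ b) :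
    |a ^ p - b ^ p| ≤ p * |a - b| * max a b ^ (p - 1) := by
  wlog hab : b ≤ a generalizing a b
  · have := this hb ha (le_of_not_ge hab)
    rwa [abs_sub_comm, max_comm, abs_sub_comm b a] at this
  rw [max_eq_left hab, abs_of_nonneg (sub_nonneg.mpr hab),
    abs_of_nonneg (sub_nonneg.mpr (Real.rpow_le_rpow hb hab (by linarith)))]
  rcases ha.eq_or_lt with rfl | ha
  · have : b = 0 := le_antisymm hab hb
    subst this; simp
  have h1 : (-1 : ℝ) ≤ b / a - 1 := by have := div_nonneg hb ha.le; linarith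
  have h2 := one_add_mul_self_le_rpow_one_add h1 hp
  rw [add_sub_cancel, Real.div_rpow hb ha.le] at h2
  have h3 : a ^ p = a ^ (p - 1) * a := by rw [← Real.rpow_add_one ha.ne', sub_add_cancel]
  have h4 : 0 < a ^ p := Real.rpow_pos_of_pos ha p
  rw [le_div_iff₀ h4] at h2
  have h5 : p * (b / a - 1) * a ^ p = p * (b - a) * a ^ (p - 1) := by
    rw [h3]; field_simp
  nlinarith

/-- Increments of `x ↦ ω |⟨φ, x⟩| ^ p` in `ℓ₂`, in terms of the uniform distance. -/
theorem sum_sq_weighted_rpow_sub_le {ι : Type*} [Fintype ι] {p t b W : ℝ} (hp : 2 ≤ p) (hb : 0 ≤ b)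
    (hW : 0 ≤ W)
    {ω x y : ι → ℝ} (hω : ∀ i, 0 ≤ ω i) (hωW : ∀ i, ω i ≤ W)
    (hx : ∀ i, |x i| ≤ b) (hy : ∀ i, |y i| ≤ b) (hxy : ∀ i, |x i - y i| ≤ t)
    (hxp : ∑ i, ω i * |x i| ^ p ≤ 1) (hyp : ∑ i, ω i * |y i| ^ p ≤ 1) :
    ∑ i, (ω i * |x i| ^ p - ω i * |y i| ^ p) ^ 2 ≤ p ^ 2 * (2 * W * b ^ (p - 2)) * t ^ 2 := by
  have hpow : ∀ a : ℝ, 0 ≤ a → a ≤ b → (a ^ (p - 1)) ^ 2 ≤ b ^ (p - 2) * a ^ p := by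
    intro a ha hab
    have : (a ^ (p - 1)) ^ 2 = a ^ (p - 2) * a ^ p := by
      rcases ha.eq_or_lt with rfl | ha
      · rw [Real.zero_rpow (by linarith : p - 1 ≠ 0), Real.zero_rpow (by linarith : p ≠ 0)]; simp
      · rw [← Real.rpow_natCast, ← Real.rpow_mul ha.le, ← Real.rpow_add ha]
        congr 1; push_cast; ring
    rw [this]
    gcongr
  have hterm : ∀ i, (ω i * |x i| ^ p - ω i * |y i| ^ p) ^ 2 ≤
      p ^ 2 * t ^ 2 * W * b ^ (p - 2) * (ω i * |x i| ^ p + ω i * |y i| ^ p) := by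
    intro i
    have h1 := abs_rpow_sub_rpow_le (p := p) (by linarith) (abs_nonneg (x i)) (abs_nonneg (y i))
    have hd : |(|x i| - |y i|)| ≤ t := (abs_abs_sub_abs_le _ _).trans (hxy i)
    have ht : 0 ≤ t := (abs_nonneg _).trans hd
    have hmax : (max |x i| |y i| ^ (p - 1)) ^ 2 ≤ b ^ (p - 2) * (|x i| ^ p + |y i| ^ p) := by
      have hx0 : 0 ≤ b ^ (p - 2) * |x i| ^ p := by positivity
      have hy0 : 0 ≤ b ^ (p - 2) * |y i| ^ p := by positivity
      rw [mul_add]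
      rcases max_choice |x i| |y i| with h | h <;> rw [h]
      · linarith [hpow _ (abs_nonneg (x i)) (hx i)]
      · linarith [hpow _ (abs_nonneg (y i)) (hy i)]
    have h2 : (|x i| ^ p - |y i| ^ p) ^ 2 ≤
        p ^ 2 * t ^ 2 * (b ^ (p - 2) * (|x i| ^ p + |y i| ^ p)) := by
      rw [← sq_abs]
      calc _ ≤ (p * |(|x i| - |y i|)| * max |x i| |y i| ^ (p - 1)) ^ 2 := by gcongr
        _ = p ^ 2 * |(|x i| - |y i|)| ^ 2 * (max |x i| |y i| ^ (p - 1)) ^ 2 := by ring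
        _ ≤ _ := by gcongr
    have hω2 : ω i ^ 2 ≤ W * ω i := by nlinarith [hω i, hωW i]
    calc _ = ω i ^ 2 * (|x i| ^ p - |y i| ^ p) ^ 2 := by ring
      _ ≤ (W * ω i) * (p ^ 2 * t ^ 2 * (b ^ (p - 2) * (|x i| ^ p + |y i| ^ p))) := by
          have := mul_nonneg hW (hω i)
          gcongr
      _ = _ := by ring
  calc _ ≤ ∑ i, p ^ 2 * t ^ 2 * W * b ^ (p - 2) * (ω i * |x i| ^ p + ω i * |y i| ^ p) :=
        Finset.sum_le_sum fun i _ => hterm i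
    _ = p ^ 2 * t ^ 2 * W * b ^ (p - 2) * (∑ i, ω i * |x i| ^ p + ∑ i, ω i * |y i| ^ p) := by
        rw [← Finset.mul_sum, Finset.sum_add_distrib]
    _ ≤ p ^ 2 * t ^ 2 * W * b ^ (p - 2) * (1 + 1) := by gcongr
    _ = _ := by ring

set_option maxHeartbeats 1000000 in
theorem exists_signs_rpow {ι : Type*} [Fintype ι] {d n N : ℕ} {p : ℝ} (hp : 2 < p) (hn : 2 ≤ n)
    (hnN : n ≤ N) (hN : 100 ≤ N) (hdn : d ≤ n) (hM₁ : (N : ℝ) ≤ Fintype.card ι)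
    (hM₂ : (Fintype.card ι : ℝ) ≤ 3 / 2 * N) {ω : ι → ℝ} (hω : ∀ i, 0 ≤ ω i)
    (hωN : ∀ i, ω i ≤ 3 / (2 * N)) (φ : ι → EuclideanSpace ℝ (Fin d))
    (hφ : ∀ i, ‖φ i‖ ^ 2 ≤ 2 * n)
    (hball : ∀ ξ, ∑ i, ω i * |inner ℝ (φ i) ξ| ^ p ≤ 1 → ‖ξ‖ ≤ 1) :
    ∃ ε : ι → ℝ, (∀ i, ε i = 1 ∨ ε i = -1) ∧ |∑ i, ε i| ≤ N / 4 ∧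
      ∀ ξ, ∑ i, ω i * |inner ℝ (φ i) ξ| ^ p ≤ 1 →
        |∑ i, ε i * (ω i * |inner ℝ (φ i) ξ| ^ p)| ≤
          (6 * Real.log n) * Real.sqrt (48 * (p ^ 2 * (2 * (3 / (2 * N)) *
            Real.sqrt (2 * n) ^ (p - 2)) * (2 * n)) * Real.log (4 * Fintype.card ι)) := by
  classical
  have hn' : (2 : ℝ) ≤ n := by exact_mod_cast hn
  have hN' : (100 : ℝ) ≤ N := by exact_mod_cast hN
  have hnN' : (n : ℝ) ≤ N := by exact_mod_cast hnN
  have : Nonempty ι := Fintype.card_pos_iff.mp (by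
    have : (0 : ℝ) < Fintype.card ι := by linarith
    exact_mod_cast this)
  set M : ℝ := (Fintype.card ι : ℝ) with hM
  have hMpos : 0 < M := by linarith
  set D : ℝ := p ^ 2 * (2 * (3 / (2 * N)) * Real.sqrt (2 * n) ^ (p - 2)) with hD
  have hDpos : 0 < D := by positivity
  set Λ := Real.log (4 * M) with hΛ
  have hΛ1 : 1 ≤ Λ := by
    rw [hΛ, Real.le_log_iff_exp_le (by positivity)]
    linarith [Real.exp_one_lt_d9]
  have hexpΛ : Real.exp Λ = 4 * M := Real.exp_log (by positivity)
  set R := Real.sqrt (48 * (D * (2 * n)) * Λ) with hR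
  have hR2 : R ^ 2 = 48 * (D * (2 * n)) * Λ := Real.sq_sqrt (by positivity)
  set L := Nat.log 2 n + 1 with hL
  have h2L : (n : ℝ) < 2 ^ L := by exact_mod_cast Nat.lt_pow_succ_log_self one_lt_two n
  have hLn : L ≤ n := Nat.log_lt_self 2 (by omega)
  have hLn' : (L : ℝ) ≤ n := by exact_mod_cast hLn
  have h2n : Real.sqrt (2 * n) ^ 2 = 2 * n := Real.sq_sqrt (by positivity)
  let t : ℕ → ℝ := fun k => if k ≤ L then Real.sqrt (2 * n) / 2 ^ k else 1 / N
  have ht : ∀ k, 0 < t k := fun k => by dsimp only [t]; split_ifs <;> positivity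
  have htsq : ∀ k ≤ L, t k ^ 2 = 2 * n / 4 ^ k := fun k hk => by
    simp only [t, hk, if_true, div_pow, h2n, ← pow_mul, mul_comm k 2]
    rw [pow_mul]; norm_num
  have htf : t (L + 1) = 1 / N := by simp [t]
  let m : ℕ → ℝ := fun k =>
    if k ≤ L then 2 * Real.exp (4 * (2 * n) * Λ / t k ^ 2) else Real.exp (2 * n * Λ)
  let T : Set (EuclideanSpace ℝ (Fin d)) := {ξ | ∑ i, ω i * |inner ℝ (φ i) ξ| ^ p ≤ 1}
  have hT1 : ∀ ξ ∈ T, ‖ξ‖ ≤ 1 := fun ξ hξ => hball ξ hξ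
  have hTsup : ∀ ξ ∈ T, ∀ i, |inner ℝ (φ i) ξ| ≤ Real.sqrt (2 * n) := by
    intro ξ hξ i
    have h1 : ‖φ i‖ ≤ Real.sqrt (2 * n) := Real.le_sqrt_of_sq_le (hφ i)
    calc _ ≤ ‖φ i‖ * ‖ξ‖ := abs_real_inner_le_norm _ _
      _ ≤ Real.sqrt (2 * n) * 1 := by gcongr; exact hT1 ξ hξ
      _ = _ := mul_one _
  let near : ℕ → EuclideanSpace ℝ (Fin d) → EuclideanSpace ℝ (Fin d) → Prop :=
    fun k x y => ∀ i, |inner ℝ (φ i) (x - y)| ≤ t k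
  let f : EuclideanSpace ℝ (Fin d) → ι → ℝ := fun ξ i => ω i * |inner ℝ (φ i) ξ| ^ p
  have hfail : ∀ k < L + 1, m (k + 1) * (2 * Real.exp (-(R ^ 2 / (2 * (D * t k ^ 2))))) ≤
      4 * Real.exp (-(2 * Λ)) := by
    intro k hk
    have hkL : k ≤ L := by omega
    have htk := ht k
    have hq : R ^ 2 / (2 * (D * t k ^ 2)) = 24 * Λ * 4 ^ k := by
      rw [hR2, htsq k hkL]; field_simp; norm_num
    rw [hq]
    have h4k : (1 : ℝ) ≤ 4 ^ k := one_le_pow₀ (by norm_num)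
    by_cases hkL' : k + 1 ≤ L
    · simp only [m, hkL', if_true]
      have : 4 * (2 * n) * Λ / t (k + 1) ^ 2 = 16 * Λ * 4 ^ k := by
        rw [htsq _ hkL']; field_simp; ring
      rw [this]
      calc _ = 4 * Real.exp (16 * Λ * 4 ^ k + -(24 * Λ * 4 ^ k)) := by rw [Real.exp_add]; ring
        _ ≤ _ := by gcongr; nlinarith
    · have hkeq : k = L := by omega
      simp only [m, hkL', if_false]
      have h4L : (n : ℝ) ≤ 4 ^ k := by
        have : (4 : ℝ) ^ k = 2 ^ L * 2 ^ L := by rw [hkeq, ← mul_pow]; norm_num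
        rw [this]; nlinarith
      calc _ = 2 * Real.exp (2 * n * Λ + -(24 * Λ * 4 ^ k)) := by rw [Real.exp_add]; ring
        _ ≤ 4 * Real.exp (-(2 * Λ)) := by
          gcongr
          · norm_num
          · nlinarith
  obtain ⟨ε, hε, hbal, hmain⟩ := exists_signs_chaining near
    (fun k x i => by simpa using (ht k).le)
    (fun k x y h i => by
      have := h i
      rwa [← neg_sub, inner_neg_right, abs_neg] at this)
    T f (L + 1) m (fun k => D * t k ^ 2) (R := R) (R₀ := N / 4) (Real.sqrt_nonneg _) (by positivity)
    (fun k => by have := ht k; positivity)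
    (by
      intro k hk1 hkK S hST hsep
      by_cases hkL : k ≤ L
      · simp only [m, hkL, if_true]
        exact card_le_of_separated_of_gaussian φ (by positivity) (ht k) hφ S
          (fun x hx => hT1 x (hST hx)) hsep
      · have hkeq : k = L + 1 := by omega
        subst hkeq
        simp only [m, hkL, if_false]
        have hg := card_le_of_separated_of_grid φ (ht (L + 1)).le hφ (2 * n * N) (by positivity)
          (by
            rw [htf]; push_cast
            have hd' : (d : ℝ) ≤ n := by exact_mod_cast hdn
            have : (1 / (N : ℝ) * (2 * n * N)) ^ 2 = 4 * n * n := by field_simp; norm_num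
            rw [this]; nlinarith)
          S (fun x hx => hT1 x (hST hx)) hsep
        have hbase : (2 * (2 * n * N : ℝ) + 1) ≤ Real.exp (2 * Λ) := by
          rw [two_mul Λ, Real.exp_add, hexpΛ]; nlinarith
        calc (S.card : ℝ) ≤ (2 * (2 * n * N : ℝ) + 1) ^ d := by exact_mod_cast hg
          _ ≤ (2 * (2 * n * N : ℝ) + 1) ^ n :=
            pow_le_pow_right₀ (by have : (0:ℝ) ≤ 2 * (2 * n * N) := by positivity
                                  linarith) hdn
          _ ≤ Real.exp (2 * Λ) ^ n := by gcongr
          _ = Real.exp (2 * n * Λ) := by rw [← Real.exp_nat_mul]; ring_nf)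
    (by
      intro k _ x hx y hy hxy
      exact sum_sq_weighted_rpow_sub_le hp.le (Real.sqrt_nonneg _) (by positivity) hω hωN
        (hTsup x hx) (hTsup y hy) (fun i => by rw [← inner_sub_right]; exact hxy i) hx hy)
    (x₀ := 0)
    (by
      simp [T, Real.zero_rpow (by linarith : p ≠ 0)])
    (by ext i; simp [f, Real.zero_rpow (by linarith : p ≠ 0)])
    (fun x hx i => by simpa [t] using hTsup x hx i)
    (by
      have h1 : ∑ k ∈ Finset.range (L + 1),
          m (k + 1) * (2 * Real.exp (-(R ^ 2 / (2 * (D * t k ^ 2))))) ≤ 1 / 10 := by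
        calc _ ≤ ∑ k ∈ Finset.range (L + 1), 4 * Real.exp (-(2 * Λ)) :=
              Finset.sum_le_sum fun k hk => hfail k (Finset.mem_range.mp hk)
          _ = (L + 1) * (4 * Real.exp (-(2 * Λ))) := by simp
          _ ≤ (2 * M) * (4 * Real.exp (-(2 * Λ))) := by gcongr; linarith
          _ = 1 / (2 * M) := by
            rw [Real.exp_neg, two_mul Λ, Real.exp_add, hexpΛ]; field_simp; norm_num
          _ ≤ 1 / 10 := by gcongr; linarith
      have h2 : Real.exp (-((N / 4 : ℝ) ^ 2 / (2 * M))) ≤ 1 / 3 := by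
        have h3 : (2 : ℝ) ≤ (N / 4 : ℝ) ^ 2 / (2 * M) := by
          rw [le_div_iff₀ (by positivity)]; nlinarith
        have h4 : (3 : ℝ) ≤ Real.exp ((N / 4 : ℝ) ^ 2 / (2 * M)) := by
          linarith [Real.add_one_le_exp ((N / 4 : ℝ) ^ 2 / (2 * M))]
        rw [Real.exp_neg, ← one_div]
        gcongr
      linarith)
  refine ⟨ε, hε, hbal, fun ξ hξ => (hmain ξ hξ).trans ?_⟩
  have hrem : Real.sqrt (M * (D * t (L + 1) ^ 2)) ≤ R := by
    refine Real.sqrt_le_sqrt ?_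
    rw [htf]
    have h1 : M * (1 / N : ℝ) ^ 2 ≤ 1 := by
      rw [div_pow, one_pow, mul_one_div, div_le_one (by positivity)]; nlinarith
    have h2 : M * (D * (1 / N : ℝ) ^ 2) ≤ D := by nlinarith
    have h3 : 1 ≤ 48 * (2 * n) * Λ := by nlinarith
    nlinarith
  have hLlog : (L : ℝ) + 2 ≤ 6 * Real.log n := by
    have h1 : (Nat.log 2 n : ℝ) ≤ Real.log n / Real.log 2 := by
      have := Real.natLog_le_logb n 2
      simpa [Real.logb] using this
    have h2 := Real.log_two_gt_d9
    have h3 := Real.log_two_lt_d9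
    have h4 : Real.log 2 ≤ Real.log n := Real.log_le_log (by norm_num) hn'
    rw [le_div_iff₀ (by linarith)] at h1
    have h5 : (L : ℝ) = Nat.log 2 n + 1 := by rw [hL]; push_cast; ring
    rw [h5]
    nlinarith
  have hR0 : 0 ≤ R := Real.sqrt_nonneg _
  push_cast
  nlinarith

section LewisPosition

variable {E : Type*} [NormedAddCommGroup E] [InnerProductSpace ℝ E]

theorem hasDerivAt_norm_add_smul_rpow {p : ℝ} (hp : 2 ≤ p) (b η : E) :
    HasDerivAt (fun t : ℝ => ‖b + (t * inner ℝ η b) • η‖ ^ p)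
      (p * (‖b‖ ^ (p - 2) * inner ℝ b η ^ 2)) 0 := by
  have hfun : (fun t : ℝ => ‖b + (t * inner ℝ η b) • η‖ ^ p) =
      fun t => (‖b‖ ^ 2 + 2 * inner ℝ b η ^ 2 * t + inner ℝ b η ^ 2 * ‖η‖ ^ 2 * t ^ 2) ^ (p / 2) := by
    ext t
    have : ‖b‖ ^ 2 + 2 * inner ℝ b η ^ 2 * t + inner ℝ b η ^ 2 * ‖η‖ ^ 2 * t ^ 2 =
        ‖b + (t * inner ℝ η b) • η‖ ^ 2 := by
      rw [norm_add_sq_real, real_inner_smul_right, norm_smul, real_inner_comm b η, mul_pow,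
        Real.norm_eq_abs, sq_abs]
      ring
    rw [this, ← Real.rpow_natCast, ← Real.rpow_mul (norm_nonneg _)]
    congr 1; push_cast; ring
  rw [hfun]
  have h1 : HasDerivAt (fun t : ℝ => ‖b‖ ^ 2 + 2 * inner ℝ b η ^ 2 * t +
      inner ℝ b η ^ 2 * ‖η‖ ^ 2 * t ^ 2) (2 * inner ℝ b η ^ 2) 0 := by
    have := (((hasDerivAt_id (0 : ℝ)).const_mul (2 * inner ℝ b η ^ 2)).const_add (‖b‖ ^ 2)).fun_add
      (((hasDerivAt_id (0 : ℝ)).pow 2).const_mul (inner ℝ b η ^ 2 * ‖η‖ ^ 2))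
    simpa [add_assoc] using this
  have h2 := h1.rpow_const (p := p / 2) (Or.inr (by linarith))
  convert h2 using 1
  have : ‖b‖ ^ (p - 2) = (‖b‖ ^ 2) ^ (p / 2 - 1) := by
    rw [← Real.rpow_natCast, ← Real.rpow_mul (norm_nonneg _)]
    congr 1; push_cast; ring
  rw [this]
  simp
  ring

variable [FiniteDimensional ℝ E]

theorem clm_eq_zero_of_forall_apply_eq_zero {ι : Type*} {a : ι → E}
    (hspan : ∀ ξ, (∀ j, inner ℝ (a j) ξ = 0) → ξ = 0) {A : E →L[ℝ] E} (hA : ∀ j, A (a j) = 0) :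
    A = 0 := by
  have : ∀ η, ContinuousLinearMap.adjoint A η = 0 := fun η => hspan _ fun j => by
    rw [ContinuousLinearMap.adjoint_inner_right, hA j, inner_zero_left]
  ext x
  refine ext_inner_right ℝ fun η => ?_
  rw [← ContinuousLinearMap.adjoint_inner_right, this]
  simp

theorem isCompact_setOf_sum_norm_rpow_le {ι : Type*} [Fintype ι] {p : ℝ} (hp : 0 < p) {a : ι → E}
    (hspan : ∀ ξ, (∀ j, inner ℝ (a j) ξ = 0) → ξ = 0) :
    IsCompact {A : E →L[ℝ] E | ∑ j, ‖A (a j)‖ ^ p ≤ 1} := by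
  let Φ : (E →L[ℝ] E) →ₗ[ℝ] (ι → E) :=
    { toFun := fun A j => A (a j)
      map_add' := fun _ _ => rfl
      map_smul' := fun _ _ => rfl }
  have hΦ : Topology.IsClosedEmbedding Φ := by
    refine LinearMap.isClosedEmbedding_of_injective (LinearMap.ker_eq_bot'.mpr fun A hA => ?_)
    exact clm_eq_zero_of_forall_apply_eq_zero hspan fun j => congrFun hA j
  have hK : IsCompact {b : ι → E | ∑ j, ‖b j‖ ^ p ≤ 1} := by
    refine Metric.isCompact_of_isClosed_isBounded (isClosed_le ?_ continuous_const) ?_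
    · exact continuous_finsetSum _ fun j _ =>
        (continuous_apply j).norm.rpow_const fun _ => Or.inr hp.le
    · refine Metric.isBounded_closedBall (x := (0 : ι → E)) (r := 1) |>.subset fun b hb => ?_
      rw [mem_closedBall_zero_iff, pi_norm_le_iff_of_nonneg zero_le_one]
      intro j
      have h1 : ‖b j‖ ^ p ≤ 1 := (Finset.single_le_sum (f := fun j => ‖b j‖ ^ p)
        (fun _ _ => by positivity) (Finset.mem_univ j)).trans hb
      by_contra! h
      exact absurd h1 (not_le.mpr (Real.one_lt_rpow h hp))
  exact hΦ.isCompact_preimage hK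

/-- Lewis's theorem: a spanning family can be moved by an invertible linear map into a position in
which the associated weighted frame operator is a multiple of the identity. -/
theorem exists_lewis_position [Nontrivial E] {ι : Type*} [Fintype ι] {p : ℝ} (hp : 2 ≤ p)
    {a : ι → E} (hspan : ∀ ξ, (∀ j, inner ℝ (a j) ξ = 0) → ξ = 0) :
    ∃ A : E →L[ℝ] E, A.det ≠ 0 ∧ ∑ j, ‖A (a j)‖ ^ p = 1 ∧
      ∀ η, ‖η‖ ^ 2 =
        Module.finrank ℝ E * ∑ j, ‖A (a j)‖ ^ (p - 2) * inner ℝ (A (a j)) η ^ 2 := by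
  have hp0 : 0 < p := by linarith
  set d := Module.finrank ℝ E with hd
  have hdpos : 0 < d := Module.finrank_pos
  have hdpos' : (0 : ℝ) < d := by exact_mod_cast hdpos
  let F : (E →L[ℝ] E) → ℝ := fun A => ∑ j, ‖A (a j)‖ ^ p
  have hF0 : ∀ A, 0 ≤ F A := fun A => Finset.sum_nonneg fun _ _ => by positivity
  have hFsmul : ∀ (c : ℝ) A, 0 ≤ c → F (c • A) = c ^ p * F A := fun c A hc => by
    simp only [F, smul_apply, norm_smul, Real.norm_eq_abs, abs_of_nonneg hc,
      Real.mul_rpow hc (norm_nonneg _), Finset.mul_sum]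
  have hdetsmul : ∀ (c : ℝ) (A : E →L[ℝ] E), (c • A).det = c ^ d * A.det := fun c A => by
    simp [ContinuousLinearMap.det, LinearMap.det_smul, hd]
  have hnormalize : ∀ A, 0 < F A → F (F A ^ (-(1 / p)) • A) = 1 := fun A hA => by
    rw [hFsmul _ _ (by positivity), ← Real.rpow_mul hA.le]
    have : -(1 / p) * p = -1 := by field_simp
    rw [this, Real.rpow_neg_one, inv_mul_cancel₀ hA.ne']
  obtain ⟨A, hAmem, hAmax⟩ := (isCompact_setOf_sum_norm_rpow_le hp0 hspan).exists_isMaxOn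
    ⟨0, by simp [Real.zero_rpow hp0.ne']⟩ ContinuousLinearMap.continuous_det.continuousOn
  have hFpos : ∀ A : E →L[ℝ] E, A.det ≠ 0 → 0 < F A := fun A hA => by
    refine lt_of_le_of_ne (hF0 A) fun h => hA ?_
    have h1 := (Finset.sum_eq_zero_iff_of_nonneg fun j _ => by positivity).mp h.symm
    have : A = 0 := clm_eq_zero_of_forall_apply_eq_zero hspan fun j => by
      simpa [Real.rpow_eq_zero (norm_nonneg _) hp0.ne'] using h1 j (Finset.mem_univ j)
    rw [this]
    have := hdetsmul 0 0
    rwa [zero_smul, zero_pow hdpos.ne', zero_mul] at this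
  have hle : ∀ B : E →L[ℝ] E, 0 < F B → B.det ≤ A.det * F B ^ (d / p : ℝ) := fun B hB => by
    have h1 : (F B ^ (-(1 / p)) • B).det ≤ A.det := hAmax (hnormalize B hB).le
    rw [hdetsmul, ← Real.rpow_natCast, ← Real.rpow_mul hB.le] at h1
    have h2 : -(1 / p) * (d : ℝ) = -(d / p) := by ring
    rw [h2, Real.rpow_neg hB.le, inv_mul_le_iff₀ (by positivity)] at h1
    linarith
  have hApos : 0 < A.det := by
    have h1 : (ContinuousLinearMap.id ℝ E).det = 1 := by
      simp [ContinuousLinearMap.det]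
    have h2 := hFpos (ContinuousLinearMap.id ℝ E) (by rw [h1]; exact one_ne_zero)
    have h3 := hle _ h2
    rw [h1] at h3
    by_contra! h4
    have : A.det * F (ContinuousLinearMap.id ℝ E) ^ (d / p : ℝ) ≤ 0 :=
      mul_nonpos_of_nonpos_of_nonneg h4 (by positivity)
    linarith
  have hFA : F A = 1 := by
    refine le_antisymm hAmem ?_
    have h1 := hFpos A hApos.ne'
    have h2 := hle A h1
    by_contra! h3
    have h4 : F A ^ (d / p : ℝ) < 1 := Real.rpow_lt_one h1.le h3 (by positivity)
    nlinarith
  refine ⟨A, hApos.ne', hFA, fun η => ?_⟩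
  let P : ℝ → (E →L[ℝ] E) := fun t =>
    LinearMap.toContinuousLinearMap (LinearMap.transvection (t • (innerₛₗ ℝ η)) η)
  have hPA : ∀ t j, (P t ∘L A) (a j) = A (a j) + (t * inner ℝ η (A (a j))) • η := fun t j => by
    simp [P, LinearMap.transvection.apply]
  have hdet : ∀ t, (P t ∘L A).det = (1 + t * ‖η‖ ^ 2) * A.det := fun t => by
    simp only [ContinuousLinearMap.det, ContinuousLinearMap.toLinearMap_comp, LinearMap.det_comp]
    simp [P, LinearMap.transvection.det]
  have hderivF : HasDerivAt (fun t => F (P t ∘L A))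
      (∑ j, p * (‖A (a j)‖ ^ (p - 2) * inner ℝ (A (a j)) η ^ 2)) 0 := by
    simp only [F, hPA]
    exact HasDerivAt.fun_sum fun j _ => hasDerivAt_norm_add_smul_rpow hp _ _
  have hF0A : F (P 0 ∘L A) = 1 := by
    rw [← hFA]; simp only [F, hPA]; simp
  let G : ℝ → ℝ := fun t => F (P t ∘L A) ^ (d / p : ℝ) - (1 + t * ‖η‖ ^ 2)
  have hderivG := (hderivF.rpow_const (p := (d / p : ℝ)) (Or.inl (by rw [hF0A]; norm_num))).sub
    (((hasDerivAt_id (0 : ℝ)).mul_const (‖η‖ ^ 2)).const_add 1)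
  have hmin : IsLocalMin G 0 := by
    have hev : ∀ᶠ t in nhds (0 : ℝ), 0 < F (P t ∘L A) :=
      hderivF.continuousAt.eventually (lt_mem_nhds (by change 0 < F (P 0 ∘L A); rw [hF0A]; norm_num))
    filter_upwards [hev] with t ht
    have h1 := hle _ ht
    rw [hdet, mul_comm, mul_le_mul_iff_right₀ hApos] at h1
    simp only [G, hF0A, Real.one_rpow]
    linarith
  have := hmin.hasDerivAt_eq_zero hderivG
  rw [hF0A, Real.one_rpow, ← Finset.mul_sum] at this
  field_simp at this
  linarith

end LewisPosition

theorem norm_sq_le_of_sum_inner_rpow_le {E ι : Type*} [NormedAddCommGroup E]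
    [InnerProductSpace ℝ E] [Fintype ι] {p c : ℝ} (hp : 2 < p) (hc : 0 ≤ c) {b : ι → E}
    (hb : ∑ j, ‖b j‖ ^ p ≤ 1) {η : E}
    (hη : ‖η‖ ^ 2 = c * ∑ j, ‖b j‖ ^ (p - 2) * inner ℝ (b j) η ^ 2)
    (h : ∑ j, |inner ℝ (b j) η| ^ p ≤ 1) : ‖η‖ ^ 2 ≤ c := by
  have hconj : (p / (p - 2)).HolderConjugate (p / 2) := by
    refine Real.holderConjugate_iff.mpr ⟨?_, ?_⟩
    · rw [one_lt_div (by linarith)]; linarith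
    · have : p - 2 ≠ 0 := by linarith
      field_simp; ring
  have hH := Real.inner_le_Lp_mul_Lq Finset.univ (fun j => ‖b j‖ ^ (p - 2))
    (fun j => inner ℝ (b j) η ^ 2) hconj
  have h1 : ∀ j, |‖b j‖ ^ (p - 2)| ^ (p / (p - 2)) = ‖b j‖ ^ p := fun j => by
    rw [abs_of_nonneg (by positivity), ← Real.rpow_mul (norm_nonneg _),
      mul_div_cancel₀ _ (by linarith)]
  have h2 : ∀ j, |inner ℝ (b j) η ^ 2| ^ (p / 2) = |inner ℝ (b j) η| ^ p := fun j => by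
    rw [abs_pow, ← Real.rpow_natCast, ← Real.rpow_mul (abs_nonneg _)]
    congr 1; push_cast; ring
  simp only [h1, h2] at hH
  have h3 : (∑ j, ‖b j‖ ^ p) ^ (1 / (p / (p - 2))) ≤ 1 := by
    refine Real.rpow_le_one (by positivity) hb ?_
    have : 0 < p - 2 := by linarith
    positivity
  have h4 : (∑ j, |inner ℝ (b j) η| ^ p) ^ (1 / (p / 2)) ≤ 1 :=
    Real.rpow_le_one (by positivity) h (by positivity)
  have h5 := hH.trans (mul_le_one₀ h3 (by positivity) h4)
  rw [hη]
  exact mul_le_of_le_one_right hc h5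

/-- Lewis's change of density, regularized so that the density is bounded from below. -/
theorem exists_change_of_density {ι : Type*} [Fintype ι] [Nonempty ι] {p : ℝ} (hp : 2 < p)
    (X : Submodule ℝ (ι → ℝ)) :
    ∃ (w : ι → ℝ) (φ : ι → EuclideanSpace ℝ (Fin (Module.finrank ℝ X))),
      (∀ j, 0 ≤ w j) ∧ ∑ j, w j = 1 ∧ (∀ j, ‖φ j‖ ^ 2 ≤ 2 * Module.finrank ℝ X) ∧
      (∀ ζ, ∑ j, (w j + 1 / Fintype.card ι) / 2 * |inner ℝ (φ j) ζ| ^ p ≤ 1 → ‖ζ‖ ≤ 1) ∧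
      ∀ x ∈ X, ∃ ζ, ∀ j,
        |x j| ^ p = (w j + 1 / Fintype.card ι) / 2 * |inner ℝ (φ j) ζ| ^ p := by
  have hp0 : 0 < p := by linarith
  have hcard : (0 : ℝ) < Fintype.card ι := by exact_mod_cast Fintype.card_pos
  set d := Module.finrank ℝ X with hd
  let E := EuclideanSpace ℝ (Fin d)
  let e : E ≃ₗ[ℝ] X := LinearEquiv.ofFinrankEq _ _ (by simp [E, hd])
  let a : ι → E := fun j => (InnerProductSpace.toDual ℝ E).symm
    (LinearMap.toContinuousLinearMap (LinearMap.proj j ∘ₗ X.subtype ∘ₗ e.toLinearMap))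
  have ha : ∀ j ξ, inner ℝ (a j) ξ = (e ξ : ι → ℝ) j := fun j ξ => by
    simp [a, InnerProductSpace.toDual_symm_apply]
  have hspan : ∀ ξ, (∀ j, inner ℝ (a j) ξ = 0) → ξ = 0 := fun ξ h => by
    refine e.map_eq_zero_iff.mp (Subtype.ext (funext fun j => ?_))
    rw [← ha, h]; rfl
  rcases Nat.eq_zero_or_pos d with hd0 | hdpos
  · have hsub : Subsingleton E := by
      refine Module.finrank_zero_iff (R := ℝ) |>.mp ?_
      simp [E, hd0]
    refine ⟨fun _ => 1 / Fintype.card ι, 0, fun _ => by positivity, ?_, fun j => by simp,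
      fun ζ _ => ?_, fun x hx => ⟨0, fun j => ?_⟩⟩
    · simp [hcard.ne']
    · rw [hsub.elim ζ 0]; simp
    · have : x j = 0 := by
        have h1 := ha j (e.symm ⟨x, hx⟩)
        rw [e.apply_symm_apply, hsub.elim (e.symm ⟨x, hx⟩) 0, inner_zero_right] at h1
        exact h1.symm
      simp [this, Real.zero_rpow hp0.ne']
  have hd' : (0 : ℝ) < d := by exact_mod_cast hdpos
  have : Nontrivial E := Module.nontrivial_of_finrank_pos (R := ℝ) (by simpa [E] using hdpos)
  obtain ⟨A, hA, hsum, hiso⟩ := exists_lewis_position hp.le hspan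
  have hfr : (Module.finrank ℝ E : ℝ) = d := by simp [E]
  rw [hfr] at hiso
  let v : ι → ℝ := fun j => (‖A (a j)‖ ^ p + 1 / Fintype.card ι) / 2
  have hv : ∀ j, 0 < v j := fun j => by positivity
  let φ : ι → E := fun j => (v j ^ (-(1 / p)) * Real.sqrt d) • A (a j)
  have hφ : ∀ j η, v j * |inner ℝ (φ j) ((Real.sqrt d)⁻¹ • η)| ^ p = |inner ℝ (A (a j)) η| ^ p :=
    fun j η => by
      have h1 : inner ℝ (φ j) ((Real.sqrt d)⁻¹ • η) = v j ^ (-(1 / p)) * inner ℝ (A (a j)) η := by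
        have := (Real.sqrt_pos.mpr hd').ne'
        simp only [φ, real_inner_smul_left, real_inner_smul_right]
        field_simp
      have h2 : -(1 / p) * p = -1 := by field_simp
      rw [h1, abs_mul, Real.mul_rpow (abs_nonneg _) (abs_nonneg _),
        abs_of_pos (Real.rpow_pos_of_pos (hv j) _), ← Real.rpow_mul (hv j).le, h2,
        Real.rpow_neg_one, mul_inv_cancel_left₀ (hv j).ne']
  refine ⟨fun j => ‖A (a j)‖ ^ p, φ, fun j => by positivity, hsum, fun j => ?_, fun ζ hζ => ?_,
    fun x hx => ?_⟩
  · have h1 : ‖A (a j)‖ ^ 2 ≤ 2 * (v j ^ (1 / p)) ^ 2 := by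
      have h3 : ‖A (a j)‖ ^ p ≤ 2 * v j := by
        have : 0 < 1 / (Fintype.card ι : ℝ) := by positivity
        simp only [v]; linarith
      have h4 : ‖A (a j)‖ ≤ (2 * v j) ^ (1 / p) := by
        rw [one_div]
        exact (Real.le_rpow_inv_iff_of_pos (norm_nonneg _) (by linarith [hv j]) hp0).mpr h3
      rw [Real.mul_rpow zero_le_two (hv j).le] at h4
      have h5 : ((2 : ℝ) ^ (1 / p)) ^ 2 ≤ 2 := by
        rw [← Real.rpow_natCast, ← Real.rpow_mul zero_le_two]
        calc (2 : ℝ) ^ (1 / p * (2 : ℕ)) ≤ 2 ^ (1 : ℝ) := by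
              refine Real.rpow_le_rpow_of_exponent_le one_le_two ?_
              push_cast
              rw [one_div_mul_eq_div, div_le_one hp0]; exact hp.le
          _ = 2 := Real.rpow_one _
      calc ‖A (a j)‖ ^ 2 ≤ (2 ^ (1 / p) * v j ^ (1 / p)) ^ 2 := by gcongr
        _ = (2 ^ (1 / p)) ^ 2 * (v j ^ (1 / p)) ^ 2 := mul_pow _ _ _
        _ ≤ _ := by gcongr
    have hpos := Real.rpow_pos_of_pos (hv j) (1 / p)
    have h2 : ‖φ j‖ ^ 2 = d * (‖A (a j)‖ ^ 2 / (v j ^ (1 / p)) ^ 2) := by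
      simp only [φ, norm_smul, Real.norm_eq_abs, mul_pow, sq_abs, Real.sq_sqrt hd'.le]
      rw [Real.rpow_neg (hv j).le]
      field_simp
    rw [h2, mul_comm (2 : ℝ)]
    gcongr
    rwa [div_le_iff₀ (by positivity)]
  · have hs := Real.sqrt_pos.mpr hd'
    have h1 : ζ = (Real.sqrt d)⁻¹ • (Real.sqrt d • ζ) := by rw [inv_smul_smul₀ hs.ne']
    have h2 : ∑ j, |inner ℝ (A (a j)) (Real.sqrt d • ζ)| ^ p ≤ 1 := by
      simp_rw [← hφ, ← h1]
      exact hζ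
    have h3 := norm_sq_le_of_sum_inner_rpow_le hp hd'.le hsum.le (hiso _) h2
    rw [norm_smul, mul_pow, Real.norm_eq_abs, sq_abs, Real.sq_sqrt hd'.le] at h3
    exact (sq_le_one_iff₀ (norm_nonneg _)).mp (by nlinarith)
  · have hAadj : Function.Surjective (ContinuousLinearMap.adjoint A) := by
      have h1 : Function.Injective (ContinuousLinearMap.adjoint A).toLinearMap := by
        refine LinearMap.ker_eq_bot.mp (LinearMap.ker_eq_bot'.mpr fun η h => ?_)
        have h2 := (LinearMap.equivOfDetNeZero A.toLinearMap hA).surjective η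
        obtain ⟨y, hy⟩ := h2
        have h3 : A y = η := hy
        have h4 : inner ℝ y (ContinuousLinearMap.adjoint A η) = 0 := by
          rw [show ContinuousLinearMap.adjoint A η = 0 from h, inner_zero_right]
        rw [ContinuousLinearMap.adjoint_inner_right, h3] at h4
        exact inner_self_eq_zero.mp h4
      exact LinearMap.injective_iff_surjective.mp h1
    obtain ⟨η, hη⟩ := hAadj (e.symm ⟨x, hx⟩)
    refine ⟨(Real.sqrt d)⁻¹ • η, fun j => ?_⟩
    rw [show (‖A (a j)‖ ^ p + 1 / (Fintype.card ι : ℝ)) / 2 = v j from rfl, hφ,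
      ← ContinuousLinearMap.adjoint_inner_right, hη, ha, e.apply_symm_apply]

theorem exists_fiber_card_eq {N M : ℕ} {m : Fin N → ℕ} (hm : ∀ j, 1 ≤ m j) (hM : ∑ j, m j = M) :
    ∃ σ : Fin M → Fin N, Function.Surjective σ ∧
      ∀ g : Fin N → ℝ, ∑ i, g (σ i) / m (σ i) = ∑ j, g j := by
  let e : (Σ j, Fin (m j)) ≃ Fin M := Fintype.equivFinOfCardEq (by simp [hM])
  refine ⟨fun i => (e.symm i).1, fun j => ⟨e ⟨j, ⟨0, hm j⟩⟩, by simp⟩, fun g => ?_⟩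
  rw [Equiv.sum_comp e.symm (fun s => g s.1 / m s.1), Fintype.sum_sigma]
  refine Finset.sum_congr rfl fun j _ => ?_
  have : (m j : ℝ) ≠ 0 := by have := hm j; positivity
  simp; field_simp

theorem sum_filter_eq_one_of_signs {ι : Type*} [Fintype ι] {ε : ι → ℝ}
    (hε : ∀ i, ε i = 1 ∨ ε i = -1) (a : ι → ℝ) :
    ∑ i with ε i = 1, a i = (∑ i, a i + ∑ i, ε i * a i) / 2 := by
  rw [← Finset.sum_add_distrib, Finset.sum_div, Finset.sum_filter]
  refine Finset.sum_congr rfl fun i _ => ?_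
  rcases hε i with h | h <;> rw [h] <;> norm_num

theorem exists_balanced_finset_of_signs {ι : Type*} [Fintype ι] [DecidableEq ι] {ε : ι → ℝ}
    (hε : ∀ i, ε i = 1 ∨ ε i = -1) :
    ∃ S : Finset ι, ∀ T ∈ ({S, Sᶜ} : Set (Finset ι)), ∀ a : ι → ℝ,
      ∑ i ∈ T, a i ≤ (∑ i, a i + |∑ i, ε i * a i|) / 2 := by
  refine ⟨Finset.univ.filter fun i => ε i = 1, fun T hT a => ?_⟩
  have h := sum_filter_eq_one_of_signs hε a
  rcases hT with rfl | rfl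
  · rw [h]; gcongr; exact le_abs_self _
  · have h1 := Finset.sum_add_sum_compl (Finset.univ.filter fun i => ε i = 1) a
    linarith [neg_abs_le (∑ i, ε i * a i)]

theorem abs_sum_signs_le_of_homogeneous {ι E : Type*} [Fintype ι] [NormedAddCommGroup E]
    [InnerProductSpace ℝ E] {p δ : ℝ} (hp : 0 < p) {ε ω : ι → ℝ} (hω : ∀ i, 0 ≤ ω i) {φ : ι → E}
    (h : ∀ ξ, ∑ i, ω i * |inner ℝ (φ i) ξ| ^ p ≤ 1 →
      |∑ i, ε i * (ω i * |inner ℝ (φ i) ξ| ^ p)| ≤ δ) (ξ : E) :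
    |∑ i, ε i * (ω i * |inner ℝ (φ i) ξ| ^ p)| ≤ δ * ∑ i, ω i * |inner ℝ (φ i) ξ| ^ p := by
  have hterm : ∀ i, 0 ≤ ω i * |inner ℝ (φ i) ξ| ^ p := fun i => by have := hω i; positivity
  rcases (Finset.sum_nonneg fun i _ => hterm i).eq_or_lt with h0 | hpos
  · have h1 := (Finset.sum_eq_zero_iff_of_nonneg fun i _ => hterm i).mp h0.symm
    rw [← h0, Finset.sum_eq_zero fun i hi => by rw [h1 i hi, mul_zero]]
    simp
  set a := ∑ i, ω i * |inner ℝ (φ i) ξ| ^ p with ha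
  have hscale : ∀ i, ω i * |inner ℝ (φ i) (a ^ (-(1 / p)) • ξ)| ^ p =
      a⁻¹ * (ω i * |inner ℝ (φ i) ξ| ^ p) := fun i => by
    have h2 : -(1 / p) * p = -1 := by field_simp
    rw [real_inner_smul_right, abs_mul, Real.mul_rpow (abs_nonneg _) (abs_nonneg _),
      abs_of_pos (Real.rpow_pos_of_pos hpos _), ← Real.rpow_mul hpos.le, h2, Real.rpow_neg_one]
    ring
  have h1 := h (a ^ (-(1 / p)) • ξ)
  simp only [hscale, mul_left_comm _ a⁻¹, ← Finset.mul_sum] at h1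
  have h2 := h1 (by rw [← ha, inv_mul_cancel₀ hpos.ne'])
  rwa [abs_mul, abs_of_pos (inv_pos.mpr hpos), inv_mul_le_iff₀ hpos, mul_comm] at h2

theorem signs_bound_le {n N M : ℕ} {p : ℝ} (hp : 2 < p) (hn : 2 ≤ n) (hN : 100 ≤ N)
    (hM₁ : N ≤ M) (hM₂ : (M : ℝ) ≤ 3 / 2 * N) :
    (6 * Real.log n) * Real.sqrt (48 * (p ^ 2 * (2 * (3 / (2 * N)) *
        Real.sqrt (2 * n) ^ (p - 2)) * (2 * n)) * Real.log (4 * M)) / 2 ≤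
      100 * p ^ 2 * (2 : ℝ) ^ (p / 2) * Real.sqrt ((n : ℝ) ^ (p / 2) / N) *
        Real.log n * Real.sqrt (Real.log N) := by
  have hn' : (2 : ℝ) ≤ n := by exact_mod_cast hn
  have hN' : (100 : ℝ) ≤ N := by exact_mod_cast hN
  have hM' : (N : ℝ) ≤ M := by exact_mod_cast hM₁
  have hlogn : 0 ≤ Real.log n := Real.log_nonneg (by linarith)
  have hlogN : 0 ≤ Real.log N := Real.log_nonneg (by linarith)
  have hlogM₀ : 0 ≤ Real.log (4 * M) := Real.log_nonneg (by linarith)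
  have hlogM : Real.log (4 * M) ≤ 4 * Real.log N := by
    have h1 : (4 : ℝ) * Real.log N = Real.log (N ^ 4) := by rw [Real.log_pow]; norm_num
    rw [h1]
    refine Real.log_le_log (by linarith) ?_
    have h2 : (1000 : ℝ) ≤ N ^ 3 := by
      calc (1000 : ℝ) ≤ 100 ^ 3 := by norm_num
        _ ≤ N ^ 3 := by gcongr
    nlinarith
  have hpow : Real.sqrt (2 * n) ^ (p - 2) * (2 * n) = 2 ^ (p / 2) * (n : ℝ) ^ (p / 2) := by
    rw [← Real.mul_rpow zero_le_two (by linarith), Real.sqrt_eq_rpow,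
      ← Real.rpow_mul (by positivity)]
    nth_rw 2 [← Real.rpow_one (2 * (n : ℝ))]
    rw [← Real.rpow_add (by positivity)]
    congr 1; ring
  have h2p : (1 : ℝ) ≤ 2 ^ (p / 2) := Real.one_le_rpow one_le_two (by linarith)
  have hsqrt : Real.sqrt (48 * (p ^ 2 * (2 * (3 / (2 * N)) *
        Real.sqrt (2 * n) ^ (p - 2)) * (2 * n)) * Real.log (4 * M)) ≤
      24 * p * 2 ^ (p / 2) * (Real.sqrt ((n : ℝ) ^ (p / 2) / N) * Real.sqrt (Real.log N)) := by
    rw [Real.sqrt_le_left (by positivity), mul_pow, mul_pow _ (Real.sqrt (Real.log N)),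
      Real.sq_sqrt (by positivity), Real.sq_sqrt hlogN]
    have h1 : 48 * (p ^ 2 * (2 * (3 / (2 * N)) * Real.sqrt (2 * n) ^ (p - 2)) * (2 * n)) =
        144 * p ^ 2 * ((n : ℝ) ^ (p / 2) / N) * 2 ^ (p / 2) := by
      calc _ = 144 * p ^ 2 / N * (Real.sqrt (2 * n) ^ (p - 2) * (2 * n)) := by
            field_simp; ring
        _ = _ := by rw [hpow]; ring
    rw [h1]
    calc _ ≤ 144 * p ^ 2 * ((n : ℝ) ^ (p / 2) / N) * (2 ^ (p / 2) * 2 ^ (p / 2)) *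
          (4 * Real.log N) := by
          gcongr
          exact le_mul_of_one_le_left (by positivity) h2p
      _ = _ := by ring
  calc _ ≤ (6 * Real.log n) * (24 * p * 2 ^ (p / 2) *
        (Real.sqrt ((n : ℝ) ^ (p / 2) / N) * Real.sqrt (Real.log N))) / 2 := by gcongr
    _ = 72 * p * (2 ^ (p / 2) * Real.sqrt ((n : ℝ) ^ (p / 2) / N) * Real.log n *
        Real.sqrt (Real.log N)) := by ring
    _ ≤ 100 * p ^ 2 * (2 ^ (p / 2) * Real.sqrt ((n : ℝ) ^ (p / 2) / N) * Real.log n *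
        Real.sqrt (Real.log N)) := by
      gcongr
      · norm_num
      · nlinarith
    _ = _ := by ring

theorem half_le_bound_of_lt {n N : ℕ} {p : ℝ} (hp : 2 < p) (hn : 2 ≤ n) (hnN : n ≤ N)
    (hN : N < 100) :
    1 / 2 ≤ 100 * p ^ 2 * (2 : ℝ) ^ (p / 2) * Real.sqrt ((n : ℝ) ^ (p / 2) / N) *
        Real.log n * Real.sqrt (Real.log N) := by
  have hn' : (2 : ℝ) ≤ n := by exact_mod_cast hn
  have hN' : (N : ℝ) ≤ 100 := by exact_mod_cast hN.le
  have hnN' : (n : ℝ) ≤ N := by exact_mod_cast hnN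
  have h2 := Real.log_two_gt_d9
  have hlogn : 1 / 2 ≤ Real.log n := by
    linarith [Real.log_le_log (by norm_num : (0 : ℝ) < 2) hn']
  have hlogN : 1 / 2 ≤ Real.sqrt (Real.log N) := by
    refine Real.le_sqrt_of_sq_le ?_
    linarith [Real.log_le_log (by linarith : (0 : ℝ) < n) hnN']
  have h2p : (1 : ℝ) ≤ 2 ^ (p / 2) := Real.one_le_rpow one_le_two (by linarith)
  have hnp : (1 : ℝ) ≤ (n : ℝ) ^ (p / 2) := Real.one_le_rpow (by linarith) (by linarith)
  have hs : 1 / 10 ≤ Real.sqrt ((n : ℝ) ^ (p / 2) / N) := by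
    refine Real.le_sqrt_of_sq_le ?_
    rw [le_div_iff₀ (by linarith)]
    linarith
  calc (1 / 2 : ℝ) ≤ 100 * 2 ^ 2 * 1 * (1 / 10) * (1 / 2) * (1 / 2) := by norm_num
    _ ≤ _ := by gcongr

/-- The splitting construction: atoms carrying a large Lewis density are divided into equal parts,
and the resulting atoms are distributed by a suitable choice of signs. -/
theorem exists_balanced_splitting {p : ℝ} (hp : 2 < p) {n N : ℕ} (hn : 2 ≤ n) (hnN : n ≤ N)
    (hN : 100 ≤ N) {τ : Fin N → ℝ} (hτ : ∀ j, 0 ≤ τ j) {X : Submodule ℝ (Fin N → ℝ)}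
    (hX : Module.finrank ℝ X = n) :
    ∃ (M : ℕ) (m : Fin N → ℕ) (σ : Fin M → Fin N) (ε : Fin M → ℝ),
      N ≤ M ∧ (M : ℝ) ≤ 3 / 2 * N ∧ Function.Surjective σ ∧
      (∀ g : Fin N → ℝ, ∑ i, g (σ i) / m (σ i) = ∑ j, g j) ∧
      (∀ i, ε i = 1 ∨ ε i = -1) ∧ |∑ i, ε i| ≤ N / 4 ∧
      ∀ x ∈ X, |∑ i, ε i * (τ (σ i) / m (σ i) * |x (σ i)| ^ p)| ≤
        (6 * Real.log n) * Real.sqrt (48 * (p ^ 2 * (2 * (3 / (2 * N)) *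
          Real.sqrt (2 * n) ^ (p - 2)) * (2 * n)) * Real.log (4 * M)) *
          ∑ i, τ (σ i) / m (σ i) * |x (σ i)| ^ p := by
  have hp0 : 0 < p := by linarith
  have hN' : (0 : ℝ) < N := by positivity
  have : Nonempty (Fin N) := ⟨⟨0, by omega⟩⟩
  let D : (Fin N → ℝ) →ₗ[ℝ] (Fin N → ℝ) :=
    LinearMap.pi fun j => τ j ^ (1 / p) • LinearMap.proj j
  have hD : ∀ x j, |D x j| ^ p = τ j * |x j| ^ p := fun x j => by
    have h1 : 1 / p * p = 1 := by field_simp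
    have h2 : D x j = τ j ^ (1 / p) * x j := rfl
    rw [h2, abs_mul, Real.mul_rpow (abs_nonneg _) (abs_nonneg _),
      abs_of_nonneg (Real.rpow_nonneg (hτ j) _), ← Real.rpow_mul (hτ j), h1, Real.rpow_one]
  have hd : Module.finrank ℝ (X.map D) ≤ n := hX ▸ Submodule.finrank_map_le D X
  obtain ⟨w, φ, hw, hwsum, hφ, hball, hrep⟩ := exists_change_of_density hp (X.map D)
  rw [Fintype.card_fin] at hball hrep
  let m : Fin N → ℕ := fun j => ⌊N * w j / 2⌋₊ + 1
  have hmpos : ∀ j, 1 ≤ m j := fun j => by simp [m]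
  have hmpos' : ∀ j, (0 : ℝ) < m j := fun j => by exact_mod_cast hmpos j
  have hmle : ∀ j, (m j : ℝ) ≤ N * w j / 2 + 1 := fun j => by
    have := hw j
    have := Nat.floor_le (by positivity : 0 ≤ N * w j / 2)
    simp only [m]; push_cast; linarith
  have hmge : ∀ j, N * w j / 2 ≤ m j := fun j => by
    have := Nat.lt_floor_add_one (N * w j / 2)
    simp only [m]; push_cast; exact this.le
  obtain ⟨M, hM⟩ : ∃ M, ∑ j, m j = M := ⟨_, rfl⟩
  obtain ⟨σ, hσ, hσsum⟩ := exists_fiber_card_eq hmpos hM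
  have hM₁ : N ≤ M := by
    calc N = ∑ j : Fin N, 1 := by simp
      _ ≤ M := hM ▸ Finset.sum_le_sum fun j _ => hmpos j
  have hM₂ : (M : ℝ) ≤ 3 / 2 * N := by
    rw [← hM]; push_cast
    calc ∑ j, (m j : ℝ) ≤ ∑ j, (N * w j / 2 + 1) := Finset.sum_le_sum fun j _ => hmle j
      _ = 3 / 2 * N := by
        rw [Finset.sum_add_distrib, ← Finset.sum_div, ← Finset.mul_sum, hwsum]; simp; ring
  let v : Fin N → ℝ := fun j => (w j + 1 / N) / 2
  have hv : ∀ j, 0 ≤ v j := fun j => by have := hw j; positivity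
  let ω : Fin M → ℝ := fun i => v (σ i) / m (σ i)
  have hωsum : ∀ ζ, ∑ i, ω i * |inner ℝ (φ (σ i)) ζ| ^ p = ∑ j, v j * |inner ℝ (φ j) ζ| ^ p :=
    fun ζ => by
      rw [← hσsum]
      exact Finset.sum_congr rfl fun i _ => div_mul_eq_mul_div _ _ _
  have hωN : ∀ i, ω i ≤ 3 / (2 * N) := fun i => by
    have h1 := hmge (σ i)
    have h2 : (1 : ℝ) ≤ m (σ i) := by exact_mod_cast hmpos (σ i)
    have h3 : v (σ i) = (N * w (σ i) / 2 + 1 / 2) / N := by simp only [v]; field_simp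
    simp only [ω]
    rw [h3, div_div, div_le_div_iff₀ (by positivity) (by positivity)]
    nlinarith
  obtain ⟨ε, hε, hbal, hmain⟩ := exists_signs_rpow (ι := Fin M) hp hn hnN hN hd
    (by simpa using hM₁) (by simpa using hM₂) (fun i => div_nonneg (hv _) (hmpos' _).le) hωN
    (fun i => φ (σ i))
    (fun i => (hφ _).trans (by gcongr))
    (fun ζ hζ => hball ζ (by rw [hωsum] at hζ; exact hζ))
  refine ⟨M, m, σ, ε, hM₁, hM₂, hσ, hσsum, hε, hbal, fun x hx => ?_⟩
  obtain ⟨ζ, hζ⟩ := hrep (D x) (Submodule.mem_map_of_mem hx)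
  have hterm : ∀ i, τ (σ i) / m (σ i) * |x (σ i)| ^ p = ω i * |inner ℝ (φ (σ i)) ζ| ^ p :=
    fun i => by
      rw [div_mul_eq_mul_div, ← hD, hζ, ← div_mul_eq_mul_div]
  simp only [hterm]
  rw [Fintype.card_fin] at hmain
  exact abs_sum_signs_le_of_homogeneous hp0 (fun i => div_nonneg (hv _) (hmpos' _).le) hmain ζ

/-- Corollary 2.3 (i), case `1 < p < 2`: for an `n`-dimensional subspace `X` of
`L_p(N̄, τ)` (`τ` a probability measure on `{1,…,N}`, `2 ≤ n ≤ N`), there are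
`N ≤ M ≤ (3/2)N`, a probability measure `ν` on `M̄ = {1,…,M}`, a partition
`{σ_1,…,σ_N}` of `M̄` (encoded by the surjection `σ : M̄ → N̄`, `i ∈ σ_j ↔ σ i = j`)
with `∑_{i ∈ σ_j} ν{i} = τ{j}` for every `j`, and a partition `M̄ = M₁ ∪ M₂` into
two sets each of cardinality at most `(7/8)N`, such that with `Y = J_p X`
(`(J_p x)_i = x_{σ i}`), for every `y ∈ Y` and `j = 1, 2`:
`‖1_{M_j} y‖_{L_p(ν)}^p ≤
  (1/2 + C_p (n^{p/2}/N)^{1/2} (log n) (log N)^{1/2}) ‖y‖_{L_p(ν)}^p`,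
where `C_p = C p^2 2^{p/2}` with `C` an absolute constant. -/
theorem partition_bound_two_lt_p :
    ∃ C : ℝ, 0 < C ∧
      ∀ (p : ℝ), 2 < p →
      ∀ (n N : ℕ), 2 ≤ n → n ≤ N →
      ∀ (τ : Fin N → ℝ), (∀ j, 0 ≤ τ j) → ∑ j, τ j = 1 →
      ∀ (X : Submodule ℝ (Fin N → ℝ)), Module.finrank ℝ X = n →
      ∃ (M : ℕ) (ν : Fin M → ℝ) (σ : Fin M → Fin N) (M₁ : Finset (Fin M)),
        N ≤ M ∧ (M : ℝ) ≤ 3 / 2 * N ∧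
        (∀ i, 0 ≤ ν i) ∧ ∑ i, ν i = 1 ∧
        Function.Surjective σ ∧
        (∀ j, ∑ i ∈ Finset.univ.filter (fun i => σ i = j), ν i = τ j) ∧
        (M₁.card : ℝ) ≤ 7 / 8 * N ∧ ((M₁ᶜ : Finset (Fin M)).card : ℝ) ≤ 7 / 8 * N ∧
        ∀ x ∈ X, ∀ S ∈ ({M₁, M₁ᶜ} : Set (Finset (Fin M))),
          ∑ i ∈ S, ν i * |x (σ i)| ^ p ≤
            (1 / 2 + C * p ^ 2 * (2 : ℝ) ^ (p / 2) * Real.sqrt ((n : ℝ) ^ (p / 2) / N) *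
                Real.log n * Real.sqrt (Real.log N)) *
              ∑ i, ν i * |x (σ i)| ^ p := by
  refine ⟨100, by norm_num, fun p hp n N hn hnN τ hτ hτsum X hX => ?_⟩
  rcases lt_or_ge N 100 with hN | hN
  · have hbound := half_le_bound_of_lt hp hn hnN hN
    have hN2 : (2 : ℝ) ≤ N := by exact_mod_cast hn.trans hnN
    obtain ⟨S, hS⟩ := Finset.exists_subset_card_eq
      (s := (Finset.univ : Finset (Fin N))) (n := N / 2) (by simp; omega)
    have hc1 : 2 * S.card ≤ N := by omega
    have hc2 : 2 * Sᶜ.card ≤ N + 1 := by rw [Finset.card_compl, Fintype.card_fin]; omega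
    have hc1' : 2 * (S.card : ℝ) ≤ N := by exact_mod_cast hc1
    have hc2' : 2 * (Sᶜ.card : ℝ) ≤ N + 1 := by exact_mod_cast hc2
    refine ⟨N, τ, id, S, le_rfl, by linarith, hτ, hτsum, Function.surjective_id,
      fun j => by simp [Finset.sum_filter], by linarith, by linarith, fun x _ T _ => ?_⟩
    have hterm : ∀ i, 0 ≤ τ i * |x (id i)| ^ p := fun i => by have := hτ i; positivity
    calc ∑ i ∈ T, τ i * |x (id i)| ^ p ≤ ∑ i, τ i * |x (id i)| ^ p :=
          Finset.sum_le_sum_of_subset_of_nonneg (Finset.subset_univ T) fun i _ _ => hterm i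
      _ ≤ _ := le_mul_of_one_le_left (Finset.sum_nonneg fun i _ => hterm i) (by linarith)
  · obtain ⟨M, m, σ, ε, hM₁, hM₂, hσ, hσsum, hε, hbal, hmain⟩ :=
      exists_balanced_splitting hp hn hnN hN hτ hX
    obtain ⟨S, hS⟩ := exists_balanced_finset_of_signs hε
    have hcard : ∀ T ∈ ({S, Sᶜ} : Set (Finset (Fin M))), (T.card : ℝ) ≤ 7 / 8 * N :=
      fun T hT => by
        have h1 := hS T hT fun _ => 1
        simp only [Finset.sum_const, nsmul_eq_mul, mul_one, Finset.card_univ,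
          Fintype.card_fin] at h1
        linarith
    refine ⟨M, fun i => τ (σ i) / m (σ i), σ, S, hM₁, hM₂,
      fun i => div_nonneg (hτ _) (Nat.cast_nonneg _), (hσsum τ).trans hτsum, hσ, fun j => ?_,
      hcard _ (by simp), hcard _ (by simp), fun x hx T hT => ?_⟩
    · have h1 := hσsum fun k => if k = j then τ k else 0
      simp only [ite_div, zero_div, Finset.sum_ite_eq', Finset.mem_univ, if_true] at h1
      rw [Finset.sum_filter, h1]
    · have hterm : ∀ i, 0 ≤ τ (σ i) / m (σ i) * |x (σ i)| ^ p := fun i => by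
        have := hτ (σ i); positivity
      have h1 := hS T hT fun i => τ (σ i) / m (σ i) * |x (σ i)| ^ p
      have h2 := hmain x hx
      have h3 := mul_le_mul_of_nonneg_right (signs_bound_le hp hn hN hM₁ hM₂)
        (Finset.sum_nonneg fun i (_ : i ∈ Finset.univ) => hterm i)
      rw [add_mul]
      linarith
end

section
/- Let 1 < p < 2, let M and N be positive integers, and let ν be a probability measure on M̄ = {1,…,M} with ν{i} ≤ 4/N for every i. Define δ(y, z) = (Σ_{i=1}^M [ν{i}(|y_i|^p − |z_i|^p)]^2)^{1/2} for vectors y, z ∈ ℝ^M. Then for all y, z with ‖y‖_{L_p(ν)} ≤ 1 and ‖z‖_{L_p(ν)} ≤ 1, one has δ(y, z)^2 ≤ 2^6 N^{−1} ‖y − z‖_∞^p. -/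
open scoped BigOperators

theorem sq_rpow_sub_rpow_le_of_le {p a b : ℝ} (hp : 1 < p) (hp2 : p < 2) (hb : 0 ≤ b)
    (hab : b ≤ a) : (a ^ p - b ^ p) ^ 2 ≤ 4 * (a ^ p * (a - b) ^ p) := by
  rcases (hb.trans hab).eq_or_lt with rfl | ha
  · obtain rfl : b = 0 := le_antisymm hab hb
    simp [Real.zero_rpow (by linarith : p ≠ 0)]
  obtain ⟨t, rfl⟩ : ∃ t, b = a * t := ⟨b / a, by field_simp⟩
  have ht0 : 0 ≤ t := nonneg_of_mul_nonneg_right hb ha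
  have ht1 : t ≤ 1 := by nlinarith
  have bernoulli := one_add_mul_self_le_rpow_one_add (s := t - 1) (by linarith) hp.le
  rw [add_sub_cancel] at bernoulli
  have htp : t ^ p ≤ 1 := Real.rpow_le_one ht0 ht1 (by linarith)
  have hs : (1 - t) ^ 2 ≤ (1 - t) ^ p := by
    rw [← Real.rpow_two]
    exact Real.rpow_le_rpow_of_exponent_ge' (by linarith) (by linarith) (by linarith) hp2.le
  have key : (1 - t ^ p) ^ 2 ≤ 4 * (1 - t) ^ p := by
    have : 1 - t ^ p ≤ 2 * (1 - t) := by nlinarith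
    nlinarith
  rw [show a - a * t = a * (1 - t) by ring, Real.mul_rpow ha.le ht0,
    Real.mul_rpow ha.le (by linarith)]
  calc (a ^ p - a ^ p * t ^ p) ^ 2 = (a ^ p) ^ 2 * (1 - t ^ p) ^ 2 := by ring
    _ ≤ (a ^ p) ^ 2 * (4 * (1 - t) ^ p) := by gcongr
    _ = 4 * (a ^ p * (a ^ p * (1 - t) ^ p)) := by ring

theorem sq_abs_rpow_sub_abs_rpow_le {p : ℝ} (hp : 1 < p) (hp2 : p < 2) (u v : ℝ) :
    (|u| ^ p - |v| ^ p) ^ 2 ≤ 4 * (|u| ^ p + |v| ^ p) * |u - v| ^ p := by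
  wlog h : |v| ≤ |u| generalizing u v
  · have := this v u (le_of_not_ge h)
    rw [abs_sub_comm v u] at this
    linarith
  calc (|u| ^ p - |v| ^ p) ^ 2 ≤ 4 * (|u| ^ p * (|u| - |v|) ^ p) :=
        sq_rpow_sub_rpow_le_of_le hp hp2 (abs_nonneg v) h
    _ ≤ 4 * ((|u| ^ p + |v| ^ p) * |u - v| ^ p) := by
        gcongr
        · exact le_add_of_nonneg_right (by positivity)
        · exact abs_sub_abs_le_abs_sub u v
    _ = _ := by ring

/-- Let `1 < p < 2` and let `ν` be a probability measure on `{1,…,M}` with all atoms of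
mass at most `4/N`. For the Gaussian-process distance
`δ(y,z) = (∑_i [ν{i}(|y_i|^p − |z_i|^p)]^2)^{1/2}`, any `y, z` in the unit ball of
`L_p(ν)` satisfy `δ(y,z)^2 ≤ 2^6 N^{-1} ‖y − z‖_∞^p`. -/
theorem delta_dist_bound_one_lt_p_lt_two
    (p : ℝ) (hp : 1 < p) (hp2 : p < 2) (M N : ℕ) (hM : 0 < M) (hN : 0 < N)
    (ν : Fin M → ℝ) (hν0 : ∀ i, 0 ≤ ν i) (hν1 : ∑ i, ν i = 1)
    (hatom : ∀ i, ν i ≤ 4 / N)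
    (y z : Fin M → ℝ)
    (hy : ∑ i, ν i * |y i| ^ p ≤ 1) (hz : ∑ i, ν i * |z i| ^ p ≤ 1) :
    ∑ i, (ν i * (|y i| ^ p - |z i| ^ p)) ^ 2 ≤
      2 ^ 6 * (N : ℝ)⁻¹ * (sSup (Set.range fun i => |y i - z i|)) ^ p := by
  set D := sSup (Set.range fun i => |y i - z i|)
  have hle (i : Fin M) : |y i - z i| ≤ D :=
    le_csSup (Set.finite_range _).bddAbove (Set.mem_range_self i)
  have hD0 : 0 ≤ D := (abs_nonneg _).trans (hle ⟨0, hM⟩)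
  have hterm (i : Fin M) : (ν i * (|y i| ^ p - |z i| ^ p)) ^ 2 ≤
      16 / N * D ^ p * (ν i * |y i| ^ p + ν i * |z i| ^ p) := by
    have hν := hν0 i
    calc (ν i * (|y i| ^ p - |z i| ^ p)) ^ 2
        = ν i * ν i * (|y i| ^ p - |z i| ^ p) ^ 2 := by ring
      _ ≤ 4 / N * ν i * (4 * (|y i| ^ p + |z i| ^ p) * D ^ p) := by
        gcongr
        · exact hatom i
        · refine (sq_abs_rpow_sub_abs_rpow_le hp hp2 _ _).trans ?_
          gcongr
          exact hle i
      _ = _ := by ring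
  calc _ ≤ ∑ i, 16 / N * D ^ p * (ν i * |y i| ^ p + ν i * |z i| ^ p) :=
        Finset.sum_le_sum fun i _ => hterm i
    _ = 16 / N * D ^ p * (∑ i, ν i * |y i| ^ p + ∑ i, ν i * |z i| ^ p) := by
        rw [← Finset.mul_sum, Finset.sum_add_distrib]
    _ ≤ 16 / N * D ^ p * 4 := by
        gcongr
        linarith
    _ = _ := by ring
end

section
/- Let 1 < p < 2, let N ≥ n ≥ 2, let μ be a probability measure on N̄ = {1,…,N}, and let X be an n-dimensional subspace of L_p(N̄, μ). Then there exist a density α on (N̄, μ) and an absolute constant C such that, with X̃ = {x/α^{1/p} : x ∈ X}, for every t with 1 ≤ t ≤ 2n: log E(B(X̃_p), ‖·‖_{L_2(α dμ)}, t) ≤ C (p−1)^{−1} (C/t)^{2p/(2−p)} n log n. -/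
open scoped BigOperators

/-- `coverNum A d t` is the minimal number of open balls of radius `t` (with respect to
the distance function `d`, centers anywhere) needed to cover the set `A`. -/
noncomputable def coverNum {β : Type*} (A : Set β) (d : β → β → ℝ) (t : ℝ) : ℕ :=
  sInf { m : ℕ | ∃ c : Finset β, c.card = m ∧ A ⊆ ⋃ x ∈ c, { y | d x y < t } }

section Gaussian

open MeasureTheory Real
open scoped RealInnerProductSpace

variable {V : Type*} [NormedAddCommGroup V] [InnerProductSpace ℝ V]

/-- The unnormalized standard Gaussian density on an inner product space. -/
noncomputable def gaussianWeight (y : V) : ℝ := exp (-(‖y‖ ^ 2 / 2))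

omit [InnerProductSpace ℝ V] in
lemma gaussianWeight_pos (y : V) : 0 < gaussianWeight y := exp_pos _

omit [InnerProductSpace ℝ V] in
lemma gaussianWeight_neg (y : V) : gaussianWeight (-y) = gaussianWeight y := by
  simp [gaussianWeight]

omit [InnerProductSpace ℝ V] in
lemma continuous_gaussianWeight : Continuous (gaussianWeight : V → ℝ) := by
  unfold gaussianWeight; fun_prop

lemma gaussianWeight_add (x y : V) :
    gaussianWeight (y + x) = exp (-(‖x‖ ^ 2 / 2)) * (exp (-⟪x, y⟫) * gaussianWeight y) := by
  unfold gaussianWeight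
  rw [← exp_add, ← exp_add, norm_add_sq_real, real_inner_comm y x]
  congr 1
  ring

lemma exp_inner_mul_gaussianWeight_s15 (u y : V) :
    exp ⟪u, y⟫ * gaussianWeight y = exp (‖u‖ ^ 2 / 2) * gaussianWeight (y - u) := by
  unfold gaussianWeight
  rw [← exp_add, ← exp_add, norm_sub_sq_real, real_inner_comm y u]
  congr 1
  ring

lemma pow_two_mul_le_factorial_mul (k : ℕ) (s : ℝ) :
    s ^ (2 * k) ≤ (2 * k).factorial * (exp s + exp (-s)) := by
  have h := pow_div_factorial_le_exp _ (abs_nonneg s) (2 * k)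
  rw [div_le_iff₀' (by positivity), (even_two_mul k).pow_abs] at h
  refine h.trans (mul_le_mul_of_nonneg_left ?_ (by positivity))
  rcases abs_cases s with ⟨h, _⟩ | ⟨h, _⟩ <;> rw [h] <;>
    linarith [exp_pos s, exp_pos (-s)]

lemma inner_pow_mul_gaussianWeight_le {l : ℝ} (hl : 0 < l) (k : ℕ) (u y : V) :
    ⟪u, y⟫ ^ (2 * k) * gaussianWeight y ≤ (2 * k).factorial / l ^ (2 * k) *
      (exp ⟪l • u, y⟫ * gaussianWeight y + exp ⟪(-l) • u, y⟫ * gaussianWeight y) := by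
  have h := pow_two_mul_le_factorial_mul k (l * ⟪u, y⟫)
  rw [mul_pow] at h
  have h2 : ⟪u, y⟫ ^ (2 * k) ≤ (2 * k).factorial / l ^ (2 * k) *
      (exp (l * ⟪u, y⟫) + exp (-(l * ⟪u, y⟫))) := by
    rw [div_mul_eq_mul_div, le_div_iff₀' (by positivity)]; exact h
  rw [real_inner_smul_left, real_inner_smul_left, neg_mul, ← add_mul, ← mul_assoc]
  exact mul_le_mul_of_nonneg_right h2 (gaussianWeight_pos y).le

variable [FiniteDimensional ℝ V] [MeasurableSpace V] [BorelSpace V]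

lemma integrable_gaussianWeight_s15 : Integrable (gaussianWeight : V → ℝ) := by
  have h := GaussianFourier.integrable_cexp_neg_mul_sq_norm_add (V := V) (b := (1 / 2 : ℂ))
    (by norm_num) 0 0
  refine h.re.congr (Filter.Eventually.of_forall fun v => ?_)
  have : (-(1 / 2 : ℂ) * (‖v‖ : ℂ) ^ 2 + 0 * ((⟪(0 : V), v⟫ : ℝ) : ℂ))
      = ((-(‖v‖ ^ 2 / 2) : ℝ) : ℂ) := by
    push_cast; ring
  simp only [this, gaussianWeight]
  exact Complex.exp_ofReal_re _

lemma integral_gaussianWeight_pos_s15 : 0 < ∫ y : V, gaussianWeight y := by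
  refine (integral_pos_iff_support_of_nonneg (fun y => (gaussianWeight_pos y).le)
    integrable_gaussianWeight_s15).2 ?_
  have : Function.support (gaussianWeight : V → ℝ) = Set.univ := by
    ext y; simp [(gaussianWeight_pos y).ne']
  rw [this]
  exact Measure.measure_univ_pos.2 (NeZero.ne _)

lemma integrable_exp_inner_mul_gaussianWeight_s15 (u : V) :
    Integrable fun y : V => exp ⟪u, y⟫ * gaussianWeight y := by
  simp_rw [exp_inner_mul_gaussianWeight_s15]
  exact (integrable_gaussianWeight_s15.comp_sub_right u).const_mul _

lemma integral_exp_inner_mul_gaussianWeight_s15 (u : V) :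
    ∫ y : V, exp ⟪u, y⟫ * gaussianWeight y = exp (‖u‖ ^ 2 / 2) * ∫ y : V, gaussianWeight y := by
  simp_rw [exp_inner_mul_gaussianWeight_s15]
  rw [integral_const_mul, integral_sub_right_eq_self (fun y : V => gaussianWeight y)]

lemma integrable_inner_pow_mul_gaussianWeight (k : ℕ) (u : V) :
    Integrable fun y : V => ⟪u, y⟫ ^ (2 * k) * gaussianWeight y := by
  have hc := continuous_gaussianWeight (V := V)
  refine Integrable.mono' (((integrable_exp_inner_mul_gaussianWeight_s15 ((1 : ℝ) • u)).add
    (integrable_exp_inner_mul_gaussianWeight_s15 ((-1 : ℝ) • u))).const_mul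
      ((2 * k).factorial / 1 ^ (2 * k)))
    (Continuous.aestronglyMeasurable (by fun_prop)) (Filter.Eventually.of_forall fun y => ?_)
  rw [norm_of_nonneg (mul_nonneg ((even_two_mul k).pow_nonneg _) (gaussianWeight_pos y).le)]
  exact inner_pow_mul_gaussianWeight_le one_pos k u y

lemma integral_inner_pow_mul_gaussianWeight_le {k : ℕ} (hk : 1 ≤ k) {b : ℝ} (hb : 0 < b) {u : V}
    (hu : ‖u‖ ^ 2 ≤ b) :
    ∫ y : V, ⟪u, y⟫ ^ (2 * k) * gaussianWeight y ≤
      2 * (2 * k * b * exp 1) ^ k * ∫ y : V, gaussianWeight y := by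
  have hk' : (0 : ℝ) < k := by exact_mod_cast hk
  set l : ℝ := √(2 * k / b) with hl
  have hl0 : 0 < l := sqrt_pos.2 (by positivity)
  have hl2 : l ^ 2 = 2 * k / b := sq_sqrt (by positivity)
  set Z := ∫ y : V, gaussianWeight y
  have hZ : 0 < Z := integral_gaussianWeight_pos_s15
  have hint := fun c : ℝ => integrable_exp_inner_mul_gaussianWeight_s15 (c • u)
  have h1 : ∫ y : V, ⟪u, y⟫ ^ (2 * k) * gaussianWeight y ≤ (2 * k).factorial / l ^ (2 * k) *
      (exp (‖l • u‖ ^ 2 / 2) * Z + exp (‖(-l) • u‖ ^ 2 / 2) * Z) := by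
    rw [← integral_exp_inner_mul_gaussianWeight_s15, ← integral_exp_inner_mul_gaussianWeight_s15,
      ← integral_add (hint _) (hint _), ← integral_const_mul]
    exact integral_mono (integrable_inner_pow_mul_gaussianWeight k u)
      (((hint _).add (hint _)).const_mul _) fun y => inner_pow_mul_gaussianWeight_le hl0 k u y
  have h2 : exp (‖l • u‖ ^ 2 / 2) ≤ exp 1 ^ k := by
    rw [← exp_nat_mul, mul_one]
    refine exp_le_exp.2 ?_
    rw [norm_smul, mul_pow, norm_of_nonneg hl0.le, hl2]
    calc 2 * k / b * ‖u‖ ^ 2 / 2 ≤ 2 * k / b * b / 2 := by gcongr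
      _ = k := by field_simp
  have h3 : ‖(-l) • u‖ = ‖l • u‖ := by rw [neg_smul, norm_neg]
  have h4 : ((2 * k).factorial : ℝ) ≤ (2 * k : ℝ) ^ (2 * k) := by
    exact_mod_cast Nat.factorial_le_pow (2 * k)
  rw [h3] at h1
  refine h1.trans ?_
  calc (2 * k).factorial / l ^ (2 * k) * (exp (‖l • u‖ ^ 2 / 2) * Z + exp (‖l • u‖ ^ 2 / 2) * Z)
      ≤ (2 * k : ℝ) ^ (2 * k) / l ^ (2 * k) * (exp 1 ^ k * Z + exp 1 ^ k * Z) := by gcongr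
    _ = 2 * (2 * k * b * exp 1) ^ k * Z := by
      have : (2 * k : ℝ) ^ (2 * k) / l ^ (2 * k) = (2 * k * b) ^ k := by
        rw [← div_pow, pow_mul, div_pow, hl2]
        congr 1
        field_simp
      rw [this, mul_pow _ (exp 1)]
      ring

/-- A symmetric set loses at most the factor `exp (-‖x‖² / 2)` of its Gaussian mass under a
translation by `x`. -/
lemma integral_indicator_translate_ge {K : Set V} (hK : MeasurableSet K)
    (hsymm : ∀ y, -y ∈ K ↔ y ∈ K) (x : V) :
    exp (-(‖x‖ ^ 2 / 2)) * ∫ y, K.indicator gaussianWeight y ≤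
      ∫ y, ((fun y => y - x) ⁻¹' K).indicator gaussianWeight y := by
  have hint : ∀ x : V, Integrable (K.indicator fun y => gaussianWeight (y + x)) := fun x =>
    (integrable_gaussianWeight_s15.comp_add_right x).indicator hK
  have e1 : ∀ x : V, ∫ y, ((fun y => y - x) ⁻¹' K).indicator gaussianWeight y =
      ∫ y, K.indicator (fun y => gaussianWeight (y + x)) y := by
    intro x
    rw [← integral_add_right_eq_self _ x]
    congr 1
    ext y
    have : y + x ∈ (fun y => y - x) ⁻¹' K ↔ y ∈ K := by simp
    by_cases hy : y ∈ K
    · rw [Set.indicator_of_mem hy, Set.indicator_of_mem (this.2 hy)]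
    · rw [Set.indicator_of_notMem hy, Set.indicator_of_notMem (mt this.1 hy)]
  have e2 : ∫ y, K.indicator (fun y => gaussianWeight (y + x)) y =
      ∫ y, K.indicator (fun y => gaussianWeight (y + -x)) y := by
    rw [← integral_neg_eq_self]
    congr 1
    ext y
    by_cases hy : y ∈ K
    · rw [Set.indicator_of_mem hy, Set.indicator_of_mem ((hsymm y).2 hy),
        ← gaussianWeight_neg (-y + x), neg_add, neg_neg]
    · rw [Set.indicator_of_notMem hy, Set.indicator_of_notMem (mt (hsymm y).1 hy)]
  have e3 : exp (-(‖x‖ ^ 2 / 2)) * (2 * ∫ y, K.indicator gaussianWeight y) ≤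
      (∫ y, K.indicator (fun y => gaussianWeight (y + x)) y) +
        ∫ y, K.indicator (fun y => gaussianWeight (y + -x)) y := by
    rw [← integral_add (hint _) (hint _), ← integral_const_mul, ← integral_const_mul]
    refine integral_mono (((integrable_gaussianWeight_s15.indicator hK).const_mul _).const_mul _)
      ((hint _).add (hint _)) fun y => ?_
    by_cases hy : y ∈ K
    · simp only [Set.indicator_of_mem hy, gaussianWeight_add, norm_neg, inner_neg_left, neg_neg]
      rw [← mul_add, ← add_mul]
      have h2 : 2 ≤ exp (-⟪x, y⟫) + exp ⟪x, y⟫ := by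
        have := one_le_cosh ⟪x, y⟫
        rw [cosh_eq] at this
        linarith
      have := (gaussianWeight_pos y).le
      gcongr
    · simp [Set.indicator_of_notMem hy]
  rw [← e2] at e3
  rw [e1]
  linarith

end Gaussian

section Packing

open MeasureTheory Real
open scoped RealInnerProductSpace

variable {V : Type*} [NormedAddCommGroup V] [InnerProductSpace ℝ V]
variable {ι : Type*} [Fintype ι]

lemma sum_mul_inner_sub_pow_le {ν : ι → ℝ} (hν : ∀ i, 0 ≤ ν i) (φ : ι → V) (k : ℕ) (x y : V) :
    ∑ i, ν i * ⟪φ i, x - y⟫ ^ (2 * k) ≤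
      4 ^ k * (∑ i, ν i * ⟪φ i, x⟫ ^ (2 * k) + ∑ i, ν i * ⟪φ i, y⟫ ^ (2 * k)) := by
  rw [← Finset.sum_add_distrib, Finset.mul_sum]
  refine Finset.sum_le_sum fun i _ => ?_
  have he := even_two_mul k
  have h : ⟪φ i, x - y⟫ ^ (2 * k) ≤ 4 ^ k * (⟪φ i, x⟫ ^ (2 * k) + ⟪φ i, y⟫ ^ (2 * k)) := by
    rw [inner_sub_right, ← he.pow_abs, ← he.pow_abs ⟪φ i, x⟫, ← he.pow_abs ⟪φ i, y⟫]
    calc |⟪φ i, x⟫ - ⟪φ i, y⟫| ^ (2 * k) ≤ (|⟪φ i, x⟫| + |⟪φ i, y⟫|) ^ (2 * k) := by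
          gcongr; exact abs_sub _ _
      _ ≤ 2 ^ (2 * k - 1) * (|⟪φ i, x⟫| ^ (2 * k) + |⟪φ i, y⟫| ^ (2 * k)) :=
          add_pow_le (abs_nonneg _) (abs_nonneg _) _
      _ ≤ 4 ^ k * (|⟪φ i, x⟫| ^ (2 * k) + |⟪φ i, y⟫| ^ (2 * k)) := by
          gcongr
          rw [show (4 : ℝ) = 2 ^ 2 by norm_num, ← pow_mul]
          exact pow_le_pow_right₀ one_le_two (Nat.sub_le _ _)
  calc ν i * ⟪φ i, x - y⟫ ^ (2 * k)
      ≤ ν i * (4 ^ k * (⟪φ i, x⟫ ^ (2 * k) + ⟪φ i, y⟫ ^ (2 * k))) :=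
        mul_le_mul_of_nonneg_left h (hν i)
    _ = _ := by ring

variable [FiniteDimensional ℝ V]

section

variable [MeasurableSpace V] [BorelSpace V]

lemma half_integral_gaussianWeight_le {ν : ι → ℝ} (hν : ∀ i, 0 ≤ ν i) (hsum : ∑ i, ν i = 1)
    {φ : ι → V} {b : ℝ} (hb : 0 < b) (hφ : ∀ i, ‖φ i‖ ^ 2 ≤ b) {k : ℕ} (hk : 1 ≤ k) {K : Set V}
    (hK : K = {y | ∑ i, ν i * ⟪φ i, y⟫ ^ (2 * k) ≤ 4 * (2 * k * b * exp 1) ^ k}) :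
    (∫ y : V, gaussianWeight y) / 2 ≤ ∫ y, K.indicator gaussianWeight y := by
  have hk' : (0 : ℝ) < k := by exact_mod_cast hk
  have hm : MeasurableSet K := by
    rw [hK]
    exact (isClosed_le (by fun_prop) (by fun_prop)).measurableSet
  set r : ℝ := (2 * k * b * exp 1) ^ k with hr
  have hr0 : 0 < r := by positivity
  set Z := ∫ y : V, gaussianWeight y
  have hi : ∀ i, Integrable fun y : V => ν i * (⟪φ i, y⟫ ^ (2 * k) * gaussianWeight y) := fun i =>
    (integrable_inner_pow_mul_gaussianWeight k (φ i)).const_mul _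
  have h1 : ∫ y : V, ∑ i, ν i * (⟪φ i, y⟫ ^ (2 * k) * gaussianWeight y) ≤ 2 * r * Z := by
    rw [integral_finsetSum _ fun i _ => hi i]
    calc ∑ i, ∫ y : V, ν i * (⟪φ i, y⟫ ^ (2 * k) * gaussianWeight y)
        ≤ ∑ i, ν i * (2 * r * Z) := by
          refine Finset.sum_le_sum fun i _ => ?_
          rw [integral_const_mul]
          exact mul_le_mul_of_nonneg_left (integral_inner_pow_mul_gaussianWeight_le hk hb (hφ i))
            (hν i)
      _ = 2 * r * Z := by rw [← Finset.sum_mul, hsum, one_mul]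
  have h2 : Z - ∫ y, K.indicator gaussianWeight y ≤
      (4 * r)⁻¹ * ∫ y : V, ∑ i, ν i * (⟪φ i, y⟫ ^ (2 * k) * gaussianWeight y) := by
    have hK1 : Integrable (K.indicator gaussianWeight) :=
      integrable_gaussianWeight_s15.indicator hm
    rw [← integral_sub integrable_gaussianWeight_s15 hK1, ← integral_const_mul]
    refine integral_mono (integrable_gaussianWeight_s15.sub hK1)
      ((integrable_finsetSum _ fun i _ => hi i).const_mul _) fun y => ?_
    have hw := (gaussianWeight_pos y).le
    have he := fun i => (even_two_mul k).pow_nonneg ⟪φ i, y⟫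
    by_cases hy : y ∈ K
    · simp only [Set.indicator_of_mem hy, sub_self]
      exact mul_nonneg (by positivity)
        (Finset.sum_nonneg fun i _ => mul_nonneg (hν i) (mul_nonneg (he i) hw))
    · simp only [Set.indicator_of_notMem hy, sub_zero]
      simp only [hK, Set.mem_ofPred_eq, not_le] at hy
      simp_rw [← mul_assoc (ν _)]
      rw [← Finset.sum_mul, ← mul_assoc]
      refine le_mul_of_one_le_left hw ?_
      rw [inv_mul_eq_div, one_le_div (by positivity)]
      exact hy.le
  have h3 : (4 * r)⁻¹ * ∫ y : V, ∑ i, ν i * (⟪φ i, y⟫ ^ (2 * k) * gaussianWeight y) ≤ Z / 2 := by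
    calc _ ≤ (4 * r)⁻¹ * (2 * r * Z) := by gcongr
      _ = Z / 2 := by field_simp; norm_num
  linarith

end

/-- Dual Sudakov inequality for the `L_{2k}` norm: a subset of a Euclidean ball that is separated in
the `L_{2k}` norm has few elements. -/
theorem card_le_of_separated {ν : ι → ℝ} (hν : ∀ i, 0 ≤ ν i) (hsum : ∑ i, ν i = 1)
    {φ : ι → V} {b : ℝ} (hb : 0 < b) (hφ : ∀ i, ‖φ i‖ ^ 2 ≤ b) {k : ℕ} (hk : 1 ≤ k)
    {S : Finset V} {c₀ : V} {r τ : ℝ} (hτ : 0 < τ) (hS : ∀ c ∈ S, ‖c - c₀‖ ^ 2 ≤ r)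
    (hsep : ∀ c ∈ S, ∀ c' ∈ S, c ≠ c' → τ ^ (2 * k) ≤ ∑ i, ν i * ⟪φ i, c - c'⟫ ^ (2 * k)) :
    (S.card : ℝ) ≤ 2 * exp (100 * k * b * r / τ ^ 2) := by
  borelize V
  have hk' : (0 : ℝ) < k := by exact_mod_cast hk
  obtain ⟨K, hK⟩ : ∃ K : Set V,
      K = {y | ∑ i, ν i * ⟪φ i, y⟫ ^ (2 * k) ≤ 4 * (2 * k * b * exp 1) ^ k} := ⟨_, rfl⟩
  have hm : MeasurableSet K := by
    rw [hK]
    exact (isClosed_le (by fun_prop) (by fun_prop)).measurableSet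
  have hsymm : ∀ y, -y ∈ K ↔ y ∈ K := fun y => by
    simp [hK, inner_neg_right, (even_two_mul k).neg_pow]
  set Z := ∫ y : V, gaussianWeight y with hZ
  have hZ0 : 0 < Z := integral_gaussianWeight_pos_s15
  have hhalf := half_integral_gaussianWeight_le hν hsum hb hφ hk hK
  set l : ℝ := √(200 * k * b / τ ^ 2)
  have hl0 : 0 < l := sqrt_pos.2 (by positivity)
  have hl2 : l ^ 2 = 200 * k * b / τ ^ 2 := sq_sqrt (by positivity)
  have hdisj : ∀ y : V, ∀ c ∈ S, ∀ c' ∈ S, y - l • (c - c₀) ∈ K → y - l • (c' - c₀) ∈ K →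
      c = c' := by
    intro y c hc c' hc' h h'
    by_contra hne
    have h1 := sum_mul_inner_sub_pow_le hν φ k (y - l • (c' - c₀)) (y - l • (c - c₀))
    have h2 : (y - l • (c' - c₀)) - (y - l • (c - c₀)) = l • (c - c') := by
      simp only [smul_sub]; abel
    simp only [hK, Set.mem_ofPred_eq] at h h'
    have h3 : ∑ i, ν i * ⟪φ i, l • (c - c')⟫ ^ (2 * k) =
        l ^ (2 * k) * ∑ i, ν i * ⟪φ i, c - c'⟫ ^ (2 * k) := by
      rw [Finset.mul_sum]
      refine Finset.sum_congr rfl fun i _ => ?_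
      rw [real_inner_smul_right, mul_pow]; ring
    rw [h2, h3] at h1
    have h4 : (200 * k * b) ^ k ≤ (64 * k * b * exp 1) ^ k := by
      calc (200 * k * b) ^ k = l ^ (2 * k) * τ ^ (2 * k) := by
            rw [pow_mul, pow_mul, hl2, ← mul_pow]; congr 1; field_simp
        _ ≤ l ^ (2 * k) * ∑ i, ν i * ⟪φ i, c - c'⟫ ^ (2 * k) := by
            gcongr; exact hsep c hc c' hc' hne
        _ ≤ 4 ^ k * (4 * (2 * k * b * exp 1) ^ k + 4 * (2 * k * b * exp 1) ^ k) :=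
            h1.trans (by gcongr)
        _ = 8 * (8 * k * b * exp 1) ^ k := by
            rw [show (8 : ℝ) * k * b * exp 1 = 4 * (2 * k * b * exp 1) by ring, mul_pow 4]; ring
        _ ≤ 8 ^ k * (8 * k * b * exp 1) ^ k := by
            gcongr; exact le_self_pow₀ (by norm_num) (by omega)
        _ = (64 * k * b * exp 1) ^ k := by rw [← mul_pow]; ring
    have h5 := (pow_le_pow_iff_left₀ (by positivity) (by positivity) (by omega)).1 h4
    have h6 : k * b * (64 * exp 1) < k * b * 200 :=
      mul_lt_mul_of_pos_left (by linarith [exp_one_lt_d9]) (by positivity)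
    linarith
  have hle : ∀ c ∈ S, exp (-(l ^ 2 * r / 2)) * (Z / 2) ≤
      ∫ y, ((fun y => y - l • (c - c₀)) ⁻¹' K).indicator gaussianWeight y := by
    intro c hc
    refine le_trans ?_ (integral_indicator_translate_ge hm hsymm (l • (c - c₀)))
    rw [norm_smul, mul_pow, norm_of_nonneg hl0.le]
    have := hS c hc
    gcongr
  have hmeas : ∀ c : V, MeasurableSet ((fun y => y - l • (c - c₀)) ⁻¹' K) := fun c =>
    (measurable_id.sub_const _) hm
  have hsumle : ∑ c ∈ S, ∫ y, ((fun y => y - l • (c - c₀)) ⁻¹' K).indicator gaussianWeight y ≤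
      Z := by
    have hint := fun c : V => (integrable_gaussianWeight_s15 (V := V)).indicator (hmeas c)
    rw [← integral_finsetSum _ fun c _ => hint c]
    refine integral_mono (integrable_finsetSum _ fun c _ => hint c) integrable_gaussianWeight_s15
      fun y => ?_
    by_cases hy : ∃ c ∈ S, y - l • (c - c₀) ∈ K
    · obtain ⟨c, hc, hcK⟩ := hy
      change ∑ c ∈ S, ((fun y => y - l • (c - c₀)) ⁻¹' K).indicator gaussianWeight y ≤ _
      rw [Finset.sum_eq_single_of_mem c hc]
      · exact Set.indicator_apply_le' (fun _ => le_rfl) fun _ => (gaussianWeight_pos y).le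
      · intro c' hc' hne
        exact Set.indicator_of_notMem (s := (fun y => y - l • (c' - c₀)) ⁻¹' K)
          (fun h => hne (hdisj y c' hc' c hc h hcK)) gaussianWeight
    · push Not at hy
      change ∑ c ∈ S, ((fun y => y - l • (c - c₀)) ⁻¹' K).indicator gaussianWeight y ≤ _
      rw [Finset.sum_eq_zero fun c hc => Set.indicator_of_notMem
        (s := (fun y => y - l • (c - c₀)) ⁻¹' K) (hy c hc) gaussianWeight]
      exact (gaussianWeight_pos y).le
  have h1 : S.card * (exp (-(l ^ 2 * r / 2)) * (Z / 2)) ≤ Z := by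
    rw [← nsmul_eq_mul]
    exact (Finset.card_nsmul_le_sum S _ _ hle).trans hsumle
  have h2 : l ^ 2 * r / 2 = 100 * k * b * r / τ ^ 2 := by rw [hl2]; ring
  rw [h2, exp_neg] at h1
  set e := exp (100 * k * b * r / τ ^ 2)
  have he : 0 < e := exp_pos _
  have h3 : (S.card : ℝ) * (e⁻¹ * (Z / 2)) = S.card / (2 * e) * Z := by field_simp
  rw [h3] at h1
  have h4 : (S.card : ℝ) / (2 * e) ≤ 1 := le_of_mul_le_mul_right (by linarith) hZ0
  rw [div_le_one (by positivity)] at h4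
  exact h4

end Packing

section Lewis

open Real
open scoped RealInnerProductSpace

variable {V : Type*} [NormedAddCommGroup V] [InnerProductSpace ℝ V] [FiniteDimensional ℝ V]
variable {ι : Type*} [Fintype ι]

/-- The functional whose constrained determinant maximizers give the Lewis change of density. -/
noncomputable def lewisFunctional (μ : ι → ℝ) (v : ι → V) (p : ℝ) (T : V →L[ℝ] V) : ℝ :=
  ∑ i, μ i * ‖T (v i)‖ ^ p

variable {μ : ι → ℝ} {v : ι → V} {p : ℝ}

omit [FiniteDimensional ℝ V] in
lemma continuous_lewisFunctional (hp : 0 < p) : Continuous (lewisFunctional μ v p) := by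
  unfold lewisFunctional
  refine continuous_finsetSum _ fun i _ => continuous_const.mul ?_
  exact Continuous.rpow_const (by fun_prop) fun _ => Or.inr hp.le

omit [FiniteDimensional ℝ V] in
lemma lewisFunctional_smul {a : ℝ} (ha : 0 ≤ a) (T : V →L[ℝ] V) :
    lewisFunctional μ v p (a • T) = a ^ p * lewisFunctional μ v p T := by
  unfold lewisFunctional
  rw [Finset.mul_sum]
  refine Finset.sum_congr rfl fun i _ => ?_
  rw [smul_apply, norm_smul, norm_of_nonneg ha,
    mul_rpow ha (norm_nonneg _)]
  ring

lemma lewisFunctional_pos (hμ : ∀ i, 0 ≤ μ i)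
    (hv : ∀ c : V, (∀ i, 0 < μ i → ⟪c, v i⟫ = 0) → c = 0) {T : V →L[ℝ] V} (hT : T ≠ 0) :
    0 < lewisFunctional μ v p T := by
  by_contra h
  have hnn : ∀ i ∈ Finset.univ, 0 ≤ μ i * ‖T (v i)‖ ^ p := fun i _ =>
    mul_nonneg (hμ i) (rpow_nonneg (norm_nonneg _) _)
  have h0 := (Finset.sum_eq_zero_iff_of_nonneg hnn).1
    (le_antisymm (not_lt.1 h) (Finset.sum_nonneg hnn))
  apply hT
  have hadj : ContinuousLinearMap.adjoint T = 0 := by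
    ext c
    refine hv _ fun i hi => ?_
    rw [ContinuousLinearMap.adjoint_inner_left]
    have h1 := (mul_eq_zero.1 (h0 i (Finset.mem_univ i))).resolve_left hi.ne'
    have h2 : T (v i) = 0 := by
      by_contra hne
      exact (rpow_pos_of_pos (norm_pos_iff.2 hne) p).ne' h1
    rw [h2, inner_zero_right]
  simpa using congrArg ContinuousLinearMap.adjoint hadj

lemma exists_max_det [Nontrivial V] (hp : 0 < p) (hμ : ∀ i, 0 ≤ μ i)
    (hv : ∀ c : V, (∀ i, 0 < μ i → ⟪c, v i⟫ = 0) → c = 0) :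
    ∃ T : V →L[ℝ] V, lewisFunctional μ v p T = 1 ∧ T.det ≠ 0 ∧
      ∀ S : V →L[ℝ] V, |S.det| ≤
        |T.det| * lewisFunctional μ v p S ^ ((Module.finrank ℝ V : ℝ) / p) := by
  set d := Module.finrank ℝ V with hd
  have hd0 : 0 < d := Module.finrank_pos
  set F := lewisFunctional μ v p with hF
  have hFpos : ∀ T : V →L[ℝ] V, T ≠ 0 → 0 < F T := fun T => lewisFunctional_pos hμ hv
  have hscale : ∀ (a : ℝ), 0 < a → ∀ T : V →L[ℝ] V,
      |(a • T).det| = a ^ d * |T.det| := by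
    intro a ha T
    change |LinearMap.det ((a • T : V →L[ℝ] V) : V →ₗ[ℝ] V)| = _
    rw [ContinuousLinearMap.toLinearMap_smul, LinearMap.det_smul, abs_mul,
      abs_of_pos (pow_pos ha _)]
  have hFscale : ∀ (a : ℝ), 0 < a → ∀ T : V →L[ℝ] V, T ≠ 0 →
      F (a • T) ^ ((d : ℝ) / p) = a ^ d * F T ^ ((d : ℝ) / p) := by
    intro a ha T hT
    rw [hF, lewisFunctional_smul ha.le, mul_rpow (by positivity) (hFpos T hT).le, ← rpow_mul ha.le,
      mul_div_cancel₀ _ hp.ne', rpow_natCast]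
  obtain ⟨T₀, hT₀, hmax⟩ := (isCompact_sphere (0 : V →L[ℝ] V) 1).exists_isMaxOn
    (f := fun T => |T.det| / F T ^ ((d : ℝ) / p)) ⟨ContinuousLinearMap.id ℝ V, by simp⟩ (by
      refine ContinuousOn.div (ContinuousLinearMap.continuous_det.abs.continuousOn) ?_ ?_
      · exact ((continuous_lewisFunctional hp).rpow_const
          fun _ => Or.inr (by positivity)).continuousOn
      · intro T hT
        exact (rpow_pos_of_pos (hFpos T (ne_zero_of_mem_unit_sphere ⟨T, hT⟩)) _).ne')
  have hT₀0 : T₀ ≠ 0 := ne_zero_of_mem_unit_sphere ⟨T₀, hT₀⟩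
  set M := |T₀.det| / F T₀ ^ ((d : ℝ) / p) with hM
  have hle : ∀ S : V →L[ℝ] V, |S.det| ≤ M * F S ^ ((d : ℝ) / p) := by
    intro S
    rcases eq_or_ne S 0 with rfl | hS
    · change |LinearMap.det (0 : V →ₗ[ℝ] V)| ≤ _
      have h0 : LinearMap.det (0 : V →ₗ[ℝ] V) = 0 := by
        rw [LinearMap.det_zero, zero_pow hd0.ne']
      rw [h0, abs_zero]
      refine mul_nonneg (div_nonneg (abs_nonneg _) (rpow_nonneg (hFpos _ hT₀0).le _))
        (rpow_nonneg (Finset.sum_nonneg fun i _ => ?_) _)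
      exact mul_nonneg (hμ i) (rpow_nonneg (norm_nonneg _) _)
    · have hn : 0 < ‖S‖⁻¹ := inv_pos.2 (norm_pos_iff.2 hS)
      have h1 := hmax (show ‖S‖⁻¹ • S ∈ Metric.sphere (0 : V →L[ℝ] V) 1 by
        simp [norm_smul, (norm_pos_iff.2 hS).ne'])
      simp only [Set.mem_ofPred_eq] at h1
      rw [hscale _ hn, hFscale _ hn _ hS, mul_div_mul_left _ _ (pow_pos hn _).ne',
        div_le_iff₀ (rpow_pos_of_pos (hFpos S hS) _)] at h1
      exact h1
  set a := F T₀ ^ (-(1 / p)) with ha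
  have ha0 : 0 < a := rpow_pos_of_pos (hFpos _ hT₀0) _
  have haF : F (a • T₀) = 1 := by
    rw [hF, lewisFunctional_smul ha0.le, ← hF, ha, ← rpow_mul (hFpos _ hT₀0).le, neg_mul,
      one_div_mul_cancel hp.ne', rpow_neg_one, inv_mul_cancel₀ (hFpos _ hT₀0).ne']
  have haM : |(a • T₀).det| = M := by
    rw [hM, hscale _ ha0, ← mul_div_mul_left _ _ (pow_pos ha0 d).ne', ← hFscale _ ha0 _ hT₀0, haF,
      one_rpow, div_one]
  refine ⟨a • T₀, haF, ?_, fun S => by rw [haM]; exact hle S⟩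
  intro h0
  have h1 := hle (ContinuousLinearMap.id ℝ V)
  rw [← haM, h0, abs_zero, zero_mul] at h1
  have h2 : (ContinuousLinearMap.id ℝ V).det = 1 := LinearMap.det_id
  rw [h2] at h1
  norm_num at h1

omit [FiniteDimensional ℝ V] in
lemma norm_add_smul_sq {c : V} (hc : ‖c‖ = 1) (s : ℝ) (y : V) :
    ‖y + ⟪c, y⟫ • (s • c)‖ ^ 2 = ‖y‖ ^ 2 + ((1 + s) ^ 2 - 1) * ⟪c, y⟫ ^ 2 := by
  rw [norm_add_sq_real, inner_smul_right, inner_smul_right, norm_smul, norm_smul, hc,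
    real_inner_comm c y, mul_one, mul_pow, norm_eq_abs, norm_eq_abs, sq_abs, sq_abs]
  ring

/-- A concavity estimate for `x ↦ x ^ (p / 2)`. -/
lemma rpow_le_rpow_add {a u w : ℝ} (ha : 0 < a) (hw : 0 ≤ w) (hu : 0 ≤ u) (hp : 0 < p)
    (hp2 : p ≤ 2) (h : w ^ 2 = a ^ 2 + u) : w ^ p ≤ a ^ p + p / 2 * (a ^ (p - 2) * u) := by
  have hwp : w ^ p = (w ^ 2) ^ (p / 2) := by
    rw [← rpow_natCast, ← rpow_mul hw]; congr 1; push_cast; ring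
  have hap : a ^ p = (a ^ 2) ^ (p / 2) := by
    rw [← rpow_natCast, ← rpow_mul ha.le]; congr 1; push_cast; ring
  have hap2 : a ^ (p - 2) = a ^ p / a ^ 2 := by
    rw [rpow_sub ha]; norm_cast
  have h1 : a ^ 2 + u = a ^ 2 * (1 + u / a ^ 2) := by field_simp
  have h2 := rpow_one_add_le_one_add_mul_self (s := u / a ^ 2)
    (by linarith [show 0 ≤ u / a ^ 2 by positivity]) (p := p / 2) (by positivity) (by linarith)
  rw [hwp, h, h1, mul_rpow (by positivity) (by positivity), ← hap, hap2]
  calc a ^ p * (1 + u / a ^ 2) ^ (p / 2) ≤ a ^ p * (1 + p / 2 * (u / a ^ 2)) := by gcongr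
    _ = _ := by ring

/-- Approximate Lewis position: after a suitable linear change of coordinates `T`, the weights
`μ i * ‖T (v i)‖ ^ p` make the coordinates almost orthogonal. -/
theorem exists_lewis_position_s15 [Nontrivial V] (hp : 0 < p) (hp2 : p ≤ 2) (hμ : ∀ i, 0 ≤ μ i)
    (hv : ∀ c : V, (∀ i, 0 < μ i → ⟪c, v i⟫ = 0) → c = 0) :
    ∃ T : V ≃L[ℝ] V, ∑ i, μ i * ‖T (v i)‖ ^ p = 1 ∧
      ∀ c : V, ‖c‖ ^ 2 ≤ 2 * Module.finrank ℝ V *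
        ∑ i, μ i * (‖T (v i)‖ ^ (p - 2) * ⟪c, T (v i)⟫ ^ 2) := by
  obtain ⟨T, hT1, hTdet, hTmax⟩ := exists_max_det hp hμ hv
  set d := Module.finrank ℝ V with hd
  have hd0 : (0 : ℝ) < d := by exact_mod_cast Module.finrank_pos (R := ℝ) (M := V)
  have hunit : ∀ c : V, ‖c‖ = 1 →
      1 ≤ 2 * d * ∑ i, μ i * (‖T (v i)‖ ^ (p - 2) * ⟪c, T (v i)⟫ ^ 2) := by
    intro c hc
    set L := ∑ i, μ i * (‖T (v i)‖ ^ (p - 2) * ⟪c, T (v i)⟫ ^ 2) with hL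
    set s : ℝ := exp (1 / 2) - 1 with hs
    have hs1 : (1 + s) ^ 2 = exp 1 := by
      rw [hs, add_sub_cancel, ← exp_nat_mul]; norm_num
    set R : V →L[ℝ] V :=
      ContinuousLinearMap.id ℝ V + (innerSL ℝ c).smulRight (s • c) with hR
    have hRapp : ∀ y, R y = y + ⟪c, y⟫ • (s • c) := fun y => by simp [hR]
    have hRdet : R.det = 1 + s := by
      have h1 : (R : V →ₗ[ℝ] V) =
          LinearMap.transvection ((innerSL ℝ c : V →L[ℝ] ℝ) : V →ₗ[ℝ] ℝ) (s • c) := by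
        ext y
        simp [LinearMap.transvection.apply, hRapp]
      change LinearMap.det (R : V →ₗ[ℝ] V) = _
      rw [h1, LinearMap.transvection.det]
      simp [hc]
    have hmul : (R.comp T).det = R.det * T.det := LinearMap.det_comp _ _
    have h1 := hTmax (R.comp T)
    set FS := lewisFunctional μ v p (R.comp T) with hFS
    have hFS0 : 0 ≤ FS := Finset.sum_nonneg fun i _ =>
      mul_nonneg (hμ i) (rpow_nonneg (norm_nonneg _) _)
    rw [hmul, hRdet, hs, add_sub_cancel, abs_mul, abs_of_pos (exp_pos _), mul_comm] at h1
    have h2 := le_of_mul_le_mul_left h1 (abs_pos.2 hTdet)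
    have h3 : exp (p / (2 * d)) ≤ FS := by
      have h4 := rpow_le_rpow (exp_pos _).le h2 (show 0 ≤ p / d by positivity)
      rw [← rpow_mul hFS0, div_mul_div_cancel₀ hp.ne', div_self hd0.ne', rpow_one, ← exp_mul] at h4
      convert! h4 using 2
      field_simp
    have h5 : FS ≤ 1 + p / 2 * ((exp 1 - 1) * L) := by
      refine le_of_le_of_eq (b := lewisFunctional μ v p T + p / 2 * ((exp 1 - 1) * L)) ?_ (by rw [hT1])
      rw [hFS, hL]
      unfold lewisFunctional
      rw [Finset.mul_sum, Finset.mul_sum, ← Finset.sum_add_distrib]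
      refine Finset.sum_le_sum fun i _ => ?_
      have key : ‖R (T (v i))‖ ^ p ≤ ‖T (v i)‖ ^ p +
          p / 2 * (‖T (v i)‖ ^ (p - 2) * ((exp 1 - 1) * ⟪c, T (v i)⟫ ^ 2)) := by
        rcases eq_or_ne (T (v i)) 0 with h0 | h0
        · simp [h0, zero_rpow hp.ne']
        · refine rpow_le_rpow_add (norm_pos_iff.2 h0) (norm_nonneg _) ?_ hp hp2 ?_
          · exact mul_nonneg (by linarith [add_one_le_exp (1 : ℝ)]) (sq_nonneg _)
          · rw [hRapp, norm_add_smul_sq hc, hs1]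
      calc μ i * ‖(R.comp T) (v i)‖ ^ p ≤ μ i * (‖T (v i)‖ ^ p +
          p / 2 * (‖T (v i)‖ ^ (p - 2) * ((exp 1 - 1) * ⟪c, T (v i)⟫ ^ 2))) :=
            mul_le_mul_of_nonneg_left key (hμ i)
        _ = _ := by ring
    have h6 := add_one_le_exp (p / (2 * d))
    have h7 : p / 2 * (1 / d) ≤ p / 2 * ((exp 1 - 1) * L) := by
      have : p / 2 * (1 / d) = p / (2 * d) := by field_simp
      linarith
    have h8 := le_of_mul_le_mul_left h7 (by positivity)
    have hL0 : 0 ≤ L := Finset.sum_nonneg fun i _ =>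
      mul_nonneg (hμ i) (mul_nonneg (rpow_nonneg (norm_nonneg _) _) (sq_nonneg _))
    have h9 : (exp 1 - 1) * L ≤ 2 * L := by
      gcongr; linarith [exp_one_lt_d9]
    have h10 := h8.trans h9
    rw [div_le_iff₀ hd0] at h10
    linarith
  refine ⟨(LinearMap.equivOfDetNeZero (T : V →ₗ[ℝ] V) hTdet).toContinuousLinearEquiv, ?_, ?_⟩
  · exact hT1
  · intro c
    change ‖c‖ ^ 2 ≤ 2 * d * ∑ i, μ i * (‖T (v i)‖ ^ (p - 2) * ⟪c, T (v i)⟫ ^ 2)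
    rcases eq_or_ne c 0 with rfl | hc
    · simp
    have hn := norm_pos_iff.2 hc
    have h := hunit (‖c‖⁻¹ • c) (by simp [norm_smul, hn.ne'])
    have h2 : ∑ i, μ i * (‖T (v i)‖ ^ (p - 2) * ⟪‖c‖⁻¹ • c, T (v i)⟫ ^ 2) =
        (‖c‖ ^ 2)⁻¹ * ∑ i, μ i * (‖T (v i)‖ ^ (p - 2) * ⟪c, T (v i)⟫ ^ 2) := by
      rw [Finset.mul_sum]
      refine Finset.sum_congr rfl fun i _ => ?_
      rw [real_inner_smul_left, mul_pow, inv_pow]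
      ring
    rw [h2] at h
    have h3 := mul_le_mul_of_nonneg_left h (sq_nonneg ‖c‖)
    rw [mul_one] at h3
    refine h3.trans (le_of_eq ?_)
    field_simp

end Lewis

section Entropy

open Real
open scoped RealInnerProductSpace

/-- If separated finite subsets of `A` have at most `M` elements, then `A` has a net with at most
`M` elements. -/
lemma exists_net_of_separated_card_le_s15 {V : Type*} (A : Set V) (far : V → V → Prop)
    (hsymm : ∀ c c', far c c' → far c' c) {M : ℝ}
    (h : ∀ S : Finset V, (↑S ⊆ A) → (∀ c ∈ S, ∀ c' ∈ S, c ≠ c' → far c c') → (S.card : ℝ) ≤ M) :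
    ∃ S : Finset V, ↑S ⊆ A ∧ (S.card : ℝ) ≤ M ∧ ∀ c ∈ A, ∃ c' ∈ S, c' = c ∨ ¬ far c' c := by
  classical
  set cards : Set ℕ := {m | ∃ S : Finset V, ↑S ⊆ A ∧
    (∀ c ∈ S, ∀ c' ∈ S, c ≠ c' → far c c') ∧ S.card = m} with hcards
  have hne : cards.Nonempty := ⟨0, ∅, by simp, by simp, by simp⟩
  have hbdd : BddAbove cards := by
    refine ⟨⌊M⌋₊, ?_⟩
    rintro _ ⟨S, hSA, hS, rfl⟩
    exact Nat.le_floor (h S hSA hS)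
  obtain ⟨S, hSA, hS, hcard⟩ := Nat.sSup_mem hne hbdd
  refine ⟨S, hSA, h S hSA hS, fun c hc => ?_⟩
  by_contra! hcon
  have hcS : c ∉ S := fun hcS => (hcon c hcS).1 rfl
  have hmem : (insert c S).card ∈ cards := by
    refine ⟨insert c S, ?_, ?_, rfl⟩
    · rw [Finset.coe_insert]
      exact Set.insert_subset hc hSA
    · intro a ha b hb hab
      rcases Finset.mem_insert.1 ha with rfl | ha' <;>
        rcases Finset.mem_insert.1 hb with rfl | hb'
      · exact absurd rfl hab
      · exact hsymm _ _ (hcon b hb').2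
      · exact (hcon a ha').2
      · exact hS a ha' b hb' hab
  have hle := le_csSup hbdd hmem
  rw [Finset.card_insert_of_notMem hcS, hcard] at hle
  omega

lemma sq_le_threshold {p M : ℝ} (hp2 : p < 2) (hM : 0 < M) {k : ℕ} (hk : 1 ≤ k) (x : ℝ) :
    x ^ 2 ≤ M ^ (2 - p) * |x| ^ p + M ^ 2 / M ^ (2 * k) * x ^ (2 * k) := by
  have h2 : 0 ≤ M ^ 2 / M ^ (2 * k) * x ^ (2 * k) :=
    mul_nonneg (by positivity) ((even_two_mul k).pow_nonneg _)
  have h1 : 0 ≤ M ^ (2 - p) * |x| ^ p := by positivity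
  rcases eq_or_ne x 0 with rfl | hx
  · simpa using add_nonneg h1 h2
  have hx0 : 0 < |x| := abs_pos.2 hx
  rcases le_total |x| M with h | h
  · have h3 : x ^ 2 = |x| ^ (2 - p) * |x| ^ p := by
      rw [← rpow_add hx0, sub_add_cancel, rpow_two, sq_abs]
    have h4 : |x| ^ (2 - p) ≤ M ^ (2 - p) := rpow_le_rpow hx0.le h (by linarith)
    have h5 : |x| ^ (2 - p) * |x| ^ p ≤ M ^ (2 - p) * |x| ^ p := by gcongr
    linarith
  · have h3 : 1 ≤ x ^ 2 / M ^ 2 := by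
      rw [one_le_div (by positivity), ← sq_abs x]; gcongr
    have h4 : x ^ 2 / M ^ 2 ≤ (x ^ 2 / M ^ 2) ^ k := le_self_pow₀ h3 (by omega)
    rw [div_pow, ← pow_mul, ← pow_mul, div_le_iff₀ (by positivity)] at h4
    have h5 : x ^ (2 * k) / M ^ (2 * k) * M ^ 2 = M ^ 2 / M ^ (2 * k) * x ^ (2 * k) := by ring
    linarith

lemma abs_sub_rpow_le {p : ℝ} (hp : 0 < p) (hp2 : p ≤ 2) (a b : ℝ) :
    |a - b| ^ p ≤ 4 * (|a| ^ p + |b| ^ p) := by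
  have h2 : (2 : ℝ) ^ p ≤ 4 := by
    calc (2 : ℝ) ^ p ≤ 2 ^ (2 : ℝ) := rpow_le_rpow_of_exponent_le one_le_two hp2
      _ = 4 := by norm_num
  have ha : 0 ≤ |a| ^ p := by positivity
  have hb : 0 ≤ |b| ^ p := by positivity
  have h3 : |a - b| ≤ 2 * max |a| |b| := by
    linarith [abs_sub a b, le_max_left |a| |b|, le_max_right |a| |b|]
  have h4 : (max |a| |b|) ^ p ≤ |a| ^ p + |b| ^ p := by
    rcases max_cases |a| |b| with ⟨h, _⟩ | ⟨h, _⟩ <;> rw [h] <;> linarith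
  have h5 : 0 ≤ max |a| |b| := le_max_of_le_left (abs_nonneg a)
  calc |a - b| ^ p ≤ (2 * max |a| |b|) ^ p := rpow_le_rpow (abs_nonneg _) h3 hp.le
    _ = 2 ^ p * (max |a| |b|) ^ p := mul_rpow zero_le_two h5
    _ ≤ 4 * (|a| ^ p + |b| ^ p) := by gcongr

variable {V : Type*} [NormedAddCommGroup V] [InnerProductSpace ℝ V]
variable {ι : Type*} [Fintype ι] {ν : ι → ℝ} {φ : ι → V} {p : ℝ} {n : ℕ}

lemma rpow_sum_sq_le (hν : ∀ i, 0 ≤ ν i) (hp : 0 < p) (hp2 : p < 2)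
    (hφ : ∀ i, ‖φ i‖ ^ 2 ≤ 4 * n) (hiso : ∀ c, ‖c‖ ^ 2 ≤ 2 * ∑ i, ν i * ⟪φ i, c⟫ ^ 2) {c : V}
    (hc : ∑ i, ν i * |⟪φ i, c⟫| ^ p ≤ 1) :
    (∑ i, ν i * ⟪φ i, c⟫ ^ 2) ^ (p / (2 - p)) ≤ 8 * n := by
  have hp' : 0 < 2 - p := by linarith
  set a := ∑ i, ν i * ⟪φ i, c⟫ ^ 2 with ha
  have ha0 : 0 ≤ a := Finset.sum_nonneg fun i _ => mul_nonneg (hν i) (sq_nonneg _)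
  rcases ha0.eq_or_lt with h0 | h0
  · rw [← h0, zero_rpow (by positivity)]; positivity
  have hx : ∀ i, ⟪φ i, c⟫ ^ 2 ≤ 8 * n * a := fun i => by
    calc ⟪φ i, c⟫ ^ 2 = |⟪φ i, c⟫| ^ 2 := (sq_abs _).symm
      _ ≤ (‖φ i‖ * ‖c‖) ^ 2 := by gcongr; exact abs_real_inner_le_norm _ _
      _ = ‖φ i‖ ^ 2 * ‖c‖ ^ 2 := mul_pow _ _ _
      _ ≤ 4 * n * (2 * a) := by gcongr; exacts [hφ i, hiso c]
      _ = 8 * n * a := by ring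
  have hx2 : ∀ i, ⟪φ i, c⟫ ^ 2 ≤ (8 * n * a) ^ ((2 - p) / 2) * |⟪φ i, c⟫| ^ p := by
    intro i
    rcases eq_or_ne ⟪φ i, c⟫ 0 with h | h
    · rw [h]; simp [zero_rpow hp.ne']
    have h1 : ⟪φ i, c⟫ ^ 2 = (⟪φ i, c⟫ ^ 2) ^ ((2 - p) / 2) * |⟪φ i, c⟫| ^ p := by
      rw [← sq_abs, ← rpow_two, ← rpow_mul (abs_nonneg _), ← rpow_add (abs_pos.2 h)]
      congr 1; ring
    rw [h1]
    refine mul_le_mul_of_nonneg_right ?_ (by positivity)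
    exact rpow_le_rpow (sq_nonneg _) (hx i) (by positivity)
  have h2 : a ≤ (8 * n * a) ^ ((2 - p) / 2) := by
    calc a ≤ ∑ i, ν i * ((8 * n * a) ^ ((2 - p) / 2) * |⟪φ i, c⟫| ^ p) :=
          Finset.sum_le_sum fun i _ => mul_le_mul_of_nonneg_left (hx2 i) (hν i)
      _ = (8 * n * a) ^ ((2 - p) / 2) * ∑ i, ν i * |⟪φ i, c⟫| ^ p := by
          rw [Finset.mul_sum Finset.univ fun i => ν i * |⟪φ i, c⟫| ^ p]
          exact Finset.sum_congr rfl fun i _ => by ring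
      _ ≤ (8 * n * a) ^ ((2 - p) / 2) := mul_le_of_le_one_right (by positivity) hc
  have h3 := rpow_le_rpow ha0 h2 (show 0 ≤ 2 / (2 - p) by positivity)
  rw [← rpow_mul (by positivity), div_mul_div_cancel₀ (by norm_num), div_self hp'.ne', rpow_one,
    show 2 / (2 - p) = p / (2 - p) + 1 by field_simp; ring, rpow_add h0, rpow_one] at h3
  exact le_of_mul_le_mul_right h3 h0

variable [FiniteDimensional ℝ V]

lemma card_le_of_separated_of_dist_le (hν : ∀ i, 0 ≤ ν i) (hsum : ∑ i, ν i = 1) (hp : 0 < p)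
    (hp2 : p < 2) (hn : 2 ≤ n) (hφ : ∀ i, ‖φ i‖ ^ 2 ≤ 4 * n)
    (hiso : ∀ c, ‖c‖ ^ 2 ≤ 2 * ∑ i, ν i * ⟪φ i, c⟫ ^ 2) {s : ℝ} (hs : 0 < s)
    (hsn : s ^ (2 * p / (2 - p)) ≤ 2 ^ (2 * p / (2 - p)) * (8 * n)) {c₀ : V} {S : Finset V}
    (hSp : ∀ c ∈ S, ∑ i, ν i * |⟪φ i, c⟫| ^ p ≤ 1)
    (hS2 : ∀ c ∈ S, ∑ i, ν i * ⟪φ i, c - c₀⟫ ^ 2 ≤ s ^ 2)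
    (hsep : ∀ c ∈ S, ∀ c' ∈ S, c ≠ c' → (s / 2) ^ 2 ≤ ∑ i, ν i * ⟪φ i, c - c'⟫ ^ 2) :
    (S.card : ℝ) ≤ exp (1000000 * n * log n * (8 / s) ^ (2 * p / (2 - p))) := by
  have hp' : 0 < 2 - p := by linarith
  set γ := 2 * p / (2 - p) with hγ
  have hγ0 : 0 < γ := by positivity
  have hn' : (2 : ℝ) ≤ n := by exact_mod_cast hn
  have hlog : 0.69 ≤ log n := by
    have := log_le_log two_pos hn'
    linarith [log_two_gt_d9]
  set k := ⌈log n⌉₊ with hk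
  have hk1 : 1 ≤ k := Nat.one_le_ceil_iff.2 (by linarith)
  have hk3 : (k : ℝ) ≤ 3 * log n := by
    have := Nat.ceil_lt_add_one (show 0 ≤ log n by linarith)
    linarith
  have hnk : (n : ℝ) ≤ 4 ^ k := by
    calc (n : ℝ) = exp (log n) := (exp_log (by linarith)).symm
      _ ≤ exp (k * 1) := by rw [mul_one]; exact exp_le_exp.2 (Nat.le_ceil _)
      _ = exp 1 ^ k := exp_nat_mul _ _
      _ ≤ 4 ^ k := by gcongr; linarith [exp_one_lt_d9]
  set M := (s / 8) ^ (2 / (2 - p)) with hM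
  have hM0 : 0 < M := by positivity
  have hM2p : M ^ (2 - p) = (s / 8) ^ 2 := by
    rw [hM, ← rpow_mul (by positivity), div_mul_cancel₀ _ hp'.ne', rpow_two]
  have hM2 : M ^ 2 = (s / 8) ^ 2 * (s / 8) ^ γ := by
    rw [hM, ← rpow_natCast, ← rpow_mul (by positivity), ← rpow_two, ← rpow_add (by positivity)]
    congr 1
    rw [hγ]; push_cast; field_simp; ring
  have hs8 : (s / 8) ^ γ ≤ 8 * n := by
    calc (s / 8) ^ γ = (1 / 8) ^ γ * s ^ γ := by
          rw [← mul_rpow (by norm_num) hs.le]; congr 1; ring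
      _ ≤ (1 / 8) ^ γ * (2 ^ γ * (8 * n)) := by gcongr
      _ = (1 / 4) ^ γ * (8 * n) := by
          rw [← mul_assoc, ← mul_rpow (by norm_num) (by norm_num)]; norm_num
      _ ≤ 1 * (8 * n) := by
          gcongr; exact rpow_le_one (by norm_num) (by norm_num) hγ0.le
      _ = 8 * n := one_mul _
  have hinv : (8 / s) ^ γ = ((s / 8) ^ γ)⁻¹ := by
    rw [← inv_rpow (by positivity), inv_div]
  have hpow : 0 < (s / 8) ^ γ := by positivity
  have hsep' : ∀ c ∈ S, ∀ c' ∈ S, c ≠ c' →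
      (M / 2) ^ (2 * k) ≤ ∑ i, ν i * ⟪φ i, c - c'⟫ ^ (2 * k) := by
    intro c hc c' hc' hne
    have h1 := hsep c hc c' hc' hne
    set Φ := ∑ i, ν i * ⟪φ i, c - c'⟫ ^ (2 * k) with hΦ
    have h2 : ∑ i, ν i * ⟪φ i, c - c'⟫ ^ 2 ≤
        M ^ (2 - p) * ∑ i, ν i * |⟪φ i, c - c'⟫| ^ p + M ^ 2 / M ^ (2 * k) * Φ := by
      rw [hΦ, Finset.mul_sum, Finset.mul_sum, ← Finset.sum_add_distrib]
      refine Finset.sum_le_sum fun i _ => ?_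
      refine (mul_le_mul_of_nonneg_left (sq_le_threshold hp2 hM0 hk1 _) (hν i)).trans_eq ?_
      ring
    have h3 : ∑ i, ν i * |⟪φ i, c - c'⟫| ^ p ≤ 8 := by
      calc ∑ i, ν i * |⟪φ i, c - c'⟫| ^ p
          ≤ ∑ i, ν i * (4 * (|⟪φ i, c⟫| ^ p + |⟪φ i, c'⟫| ^ p)) := by
            refine Finset.sum_le_sum fun i _ => mul_le_mul_of_nonneg_left ?_ (hν i)
            rw [inner_sub_right]
            exact abs_sub_rpow_le hp hp2.le _ _
        _ = 4 * (∑ i, ν i * |⟪φ i, c⟫| ^ p + ∑ i, ν i * |⟪φ i, c'⟫| ^ p) := by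
            rw [← Finset.sum_add_distrib, Finset.mul_sum]
            exact Finset.sum_congr rfl fun i _ => by ring
        _ ≤ 8 := by linarith [hSp c hc, hSp c' hc']
    have h4 : s ^ 2 / 8 ≤ M ^ 2 / M ^ (2 * k) * Φ := by
      have : M ^ (2 - p) * ∑ i, ν i * |⟪φ i, c - c'⟫| ^ p ≤ (s / 8) ^ 2 * 8 := by
        rw [hM2p]; gcongr
      linarith
    have h5 : M ^ 2 ≤ s ^ 2 / 8 * 4 ^ k := by
      calc M ^ 2 ≤ (s / 8) ^ 2 * (8 * n) := by rw [hM2]; gcongr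
        _ = s ^ 2 / 8 * n := by ring
        _ ≤ s ^ 2 / 8 * 4 ^ k := by gcongr
    have h6 : M ^ 2 ≤ M ^ 2 / M ^ (2 * k) * Φ * 4 ^ k := h5.trans (by gcongr)
    have h7 : M ^ 2 / M ^ (2 * k) * Φ * 4 ^ k = M ^ 2 * (Φ * 4 ^ k / M ^ (2 * k)) := by ring
    rw [h7] at h6
    have h8 := (le_mul_iff_one_le_right (by positivity)).1 h6
    rw [one_le_div (by positivity)] at h8
    rw [div_pow, div_le_iff₀ (by positivity), pow_mul 2]
    norm_num
    exact h8
  have hS : ∀ c ∈ S, ‖c - c₀‖ ^ 2 ≤ 2 * s ^ 2 := fun c hc =>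
    (hiso _).trans (by linarith [hS2 c hc])
  have h1 := card_le_of_separated hν hsum (by positivity : (0 : ℝ) < 4 * n) hφ hk1
    (by positivity : 0 < M / 2) hS hsep'
  have h2 : 100 * k * (4 * n) * (2 * s ^ 2) / (M / 2) ^ 2 = 204800 * k * n * (8 / s) ^ γ := by
    rw [div_pow, hM2, hinv]; field_simp; norm_num
  have h3 : 204800 * k * n * (8 / s) ^ γ ≤ 204800 * (3 * log n) * n * (8 / s) ^ γ := by gcongr
  have h4 : log n ≤ 8 * n * log n * (8 / s) ^ γ := by
    have : 1 ≤ 8 * n * (8 / s) ^ γ := by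
      rw [hinv, ← div_eq_mul_inv, one_le_div hpow]; exact hs8
    calc log n = 1 * log n := (one_mul _).symm
      _ ≤ 8 * n * (8 / s) ^ γ * log n := by gcongr
      _ = _ := by ring
  have h5 : 0 ≤ n * log n * (8 / s) ^ γ := by positivity
  rw [h2] at h1
  calc (S.card : ℝ) ≤ 2 * exp (204800 * k * n * (8 / s) ^ γ) := h1
    _ ≤ exp (log n) * exp (204800 * k * n * (8 / s) ^ γ) := by
        gcongr; rwa [exp_log (by linarith)]
    _ = exp (log n + 204800 * k * n * (8 / s) ^ γ) := (exp_add _ _).symm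
    _ ≤ exp (1000000 * n * log n * (8 / s) ^ γ) := by
        refine exp_le_exp.2 ?_
        linarith

/-- Covering numbers of the `L_p` unit ball with respect to the `L_2` norm. -/
theorem exists_net_card_le (hν : ∀ i, 0 ≤ ν i) (hsum : ∑ i, ν i = 1) (hp : 1 < p)
    (hp2 : p < 2) (hn : 2 ≤ n) (hφ : ∀ i, ‖φ i‖ ^ 2 ≤ 4 * n)
    (hiso : ∀ c, ‖c‖ ^ 2 ≤ 2 * ∑ i, ν i * ⟪φ i, c⟫ ^ 2) {s : ℝ} (hs : 0 < s) :
    ∃ F : Finset V,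
      (F.card : ℝ) ≤ exp (1000000 * n * log n * (8 / s) ^ (2 * p / (2 - p))) ∧
      ∀ c : V, ∑ i, ν i * |⟪φ i, c⟫| ^ p ≤ 1 →
        ∃ c' ∈ F, ∑ i, ν i * ⟪φ i, c' - c⟫ ^ 2 < s ^ 2 := by
  classical
  have hp' : 0 < 2 - p := by linarith
  have hp0 : 0 < p := by linarith
  set γ := 2 * p / (2 - p) with hγ
  have hγ1 : 1 ≤ γ := by rw [hγ, one_le_div hp']; linarith
  have hγ0 : 0 < γ := by linarith
  have hlog : 0 ≤ log n := log_natCast_nonneg n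
  have hbase : ∀ s : ℝ, 0 < s → 8 * n < s ^ γ → ∃ F : Finset V,
      (F.card : ℝ) ≤ exp (1000000 * n * log n * (8 / s) ^ γ) ∧
      ∀ c : V, ∑ i, ν i * |⟪φ i, c⟫| ^ p ≤ 1 →
        ∃ c' ∈ F, ∑ i, ν i * ⟪φ i, c' - c⟫ ^ 2 < s ^ 2 := by
    intro s hs hsn
    refine ⟨{0}, ?_, fun c hc => ⟨0, by simp, ?_⟩⟩
    · rw [Finset.card_singleton, Nat.cast_one]
      exact one_le_exp (by positivity)
    · have h1 := rpow_sum_sq_le hν hp0 hp2 hφ hiso hc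
      simp only [zero_sub, inner_neg_right, neg_sq]
      by_contra! h2
      have h3 := rpow_le_rpow (sq_nonneg s) h2 (show 0 ≤ p / (2 - p) by positivity)
      rw [← rpow_two, ← rpow_mul hs.le, show 2 * (p / (2 - p)) = γ by rw [hγ]; ring] at h3
      linarith
  have main : ∀ j : ℕ, ∀ s : ℝ, 0 < s → 8 * n < (2 ^ j * s) ^ γ → ∃ F : Finset V,
      (F.card : ℝ) ≤ exp (1000000 * n * log n * (8 / s) ^ γ) ∧
      ∀ c : V, ∑ i, ν i * |⟪φ i, c⟫| ^ p ≤ 1 →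
        ∃ c' ∈ F, ∑ i, ν i * ⟪φ i, c' - c⟫ ^ 2 < s ^ 2 := by
    intro j
    induction j with
    | zero => intro s hs hsn; exact hbase s hs (by simpa using hsn)
    | succ j ih =>
      intro s hs hsn
      by_cases hlarge : 8 * n < s ^ γ
      · exact hbase s hs hlarge
      obtain ⟨F, hFcard, hF⟩ := ih (2 * s) (by positivity) (by
        rwa [pow_succ, mul_assoc] at hsn)
      set B := exp (1000000 * n * log n * (8 / (2 * s)) ^ γ) with hB
      have hlocal : ∀ c₀ : V, ∃ S : Finset V, (S.card : ℝ) ≤ B ∧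
          ∀ c, ∑ i, ν i * |⟪φ i, c⟫| ^ p ≤ 1 → ∑ i, ν i * ⟪φ i, c₀ - c⟫ ^ 2 < (2 * s) ^ 2 →
            ∃ c' ∈ S, ∑ i, ν i * ⟪φ i, c' - c⟫ ^ 2 < s ^ 2 := by
        intro c₀
        have hflip : ∀ c c' : V, ∑ i, ν i * ⟪φ i, c - c'⟫ ^ 2 = ∑ i, ν i * ⟪φ i, c' - c⟫ ^ 2 := by
          intro c c'
          refine Finset.sum_congr rfl fun i _ => ?_
          rw [← neg_sub c' c, inner_neg_right, neg_sq]
        obtain ⟨S, -, hScard, hSnet⟩ := exists_net_of_separated_card_le_s15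
          {c : V | ∑ i, ν i * |⟪φ i, c⟫| ^ p ≤ 1 ∧ ∑ i, ν i * ⟪φ i, c - c₀⟫ ^ 2 ≤ (2 * s) ^ 2}
          (fun c c' => s ^ 2 ≤ ∑ i, ν i * ⟪φ i, c - c'⟫ ^ 2)
          (fun c c' h => by rwa [hflip c' c]) (M := B) (by
            intro S hSA hsep
            refine card_le_of_separated_of_dist_le hν hsum hp0 hp2 hn hφ hiso
              (s := 2 * s) (by positivity) ?_ (fun c hc => (hSA hc).1) (fun c hc => (hSA hc).2) ?_
            · rw [mul_rpow zero_le_two hs.le]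
              gcongr
              exact not_lt.1 hlarge
            · intro c hc c' hc' hne
              rw [mul_div_cancel_left₀ _ two_ne_zero]
              exact hsep c hc c' hc' hne)
        refine ⟨S, hScard, fun c hcp hc2 => ?_⟩
        obtain ⟨c', hc', h⟩ := hSnet c ⟨hcp, by rw [hflip]; exact hc2.le⟩
        refine ⟨c', hc', ?_⟩
        rcases h with rfl | h
        · simp; positivity
        · exact not_le.1 h
      choose S hScard hSnet using hlocal
      refine ⟨F.biUnion S, ?_, fun c hc => ?_⟩
      · have h1 : ((F.biUnion S).card : ℝ) ≤ F.card * B := by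
          calc ((F.biUnion S).card : ℝ) ≤ ∑ c ∈ F, ((S c).card : ℝ) := by
                exact_mod_cast Finset.card_biUnion_le
            _ ≤ ∑ _c ∈ F, B := Finset.sum_le_sum fun c _ => hScard c
            _ = F.card * B := by rw [Finset.sum_const, nsmul_eq_mul]
        have h2 : (8 / (2 * s)) ^ γ ≤ 1 / 2 * (8 / s) ^ γ := by
          rw [show 8 / (2 * s) = 1 / 2 * (8 / s) by field_simp,
            mul_rpow (by norm_num) (by positivity)]
          gcongr
          calc (1 / 2 : ℝ) ^ γ ≤ (1 / 2) ^ (1 : ℝ) :=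
                rpow_le_rpow_of_exponent_ge (by norm_num) (by norm_num) hγ1
            _ = 1 / 2 := rpow_one _
        calc ((F.biUnion S).card : ℝ) ≤ F.card * B := h1
          _ ≤ B * B := by gcongr
          _ = exp (1000000 * n * log n * (2 * (8 / (2 * s)) ^ γ)) := by
              rw [hB, ← exp_add]; congr 1; ring
          _ ≤ exp (1000000 * n * log n * (8 / s) ^ γ) := by
              refine exp_le_exp.2 (mul_le_mul_of_nonneg_left ?_ (by positivity))
              linarith
      · obtain ⟨c₀, hc₀, h⟩ := hF c hc
        obtain ⟨c', hc', h'⟩ := hSnet c₀ c hc h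
        exact ⟨c', Finset.mem_biUnion.2 ⟨c₀, hc₀, hc'⟩, h'⟩
  obtain ⟨j, hj⟩ := pow_unbounded_of_one_lt ((8 * n + 1) / s) (one_lt_two (α := ℝ))
  rw [div_lt_iff₀ hs] at hj
  refine main j s hs ?_
  have hge : (1 : ℝ) ≤ 2 ^ j * s := by
    have : (0 : ℝ) ≤ n := Nat.cast_nonneg n
    linarith
  calc (8 * n : ℝ) < 2 ^ j * s := by linarith
    _ = (2 ^ j * s) ^ (1 : ℝ) := (rpow_one _).symm
    _ ≤ (2 ^ j * s) ^ γ := rpow_le_rpow_of_exponent_le hge hγ1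

end Entropy

section ChangeOfDensity

open Real
open scoped RealInnerProductSpace

variable {V : Type*} [NormedAddCommGroup V] [InnerProductSpace ℝ V] [FiniteDimensional ℝ V]
variable {ι : Type*} [Fintype ι] {μ : ι → ℝ} {v : ι → V} {p : ℝ} {n : ℕ}

lemma div_rpow_inv_sq {a w : ℝ} (ha : 0 < a) (hw : 0 < w) (hp : 0 < p) :
    ((a ^ p / w) ^ (1 / p)) ^ 2 = a ^ 2 / w ^ (2 / p) := by
  rw [div_rpow (by positivity) hw.le, ← rpow_mul ha.le, mul_one_div_cancel hp.ne', rpow_one,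
    div_pow, ← rpow_natCast (w ^ (1 / p)), ← rpow_mul hw.le]
  congr 2
  push_cast
  ring

/-- The Lewis change of density, made strictly positive, together with near-orthogonal
coordinates in which all evaluation functionals have norm at most `2 * √n`. -/
theorem exists_density_coordinates [Nontrivial V] (hp : 1 < p) (hp2 : p < 2)
    (hμ : ∀ i, 0 ≤ μ i) (hsum : ∑ i, μ i = 1) (hn : Module.finrank ℝ V ≤ n)
    (hv : ∀ c : V, (∀ i, 0 < μ i → ⟪c, v i⟫ = 0) → c = 0) :
    ∃ α : ι → ℝ, (∀ i, 0 < α i) ∧ ∑ i, α i * μ i = 1 ∧ ∃ (φ : ι → V) (A : V → V),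
      (∀ i, ‖φ i‖ ^ 2 ≤ 4 * n) ∧ (∀ c, ‖c‖ ^ 2 ≤ 2 * ∑ i, α i * μ i * ⟪φ i, c⟫ ^ 2) ∧
      A.Surjective ∧ ∀ i, μ i ≠ 0 → ∀ c, ⟪v i, A c⟫ / α i ^ (1 / p) = ⟪φ i, c⟫ := by
  classical
  have hp0 : 0 < p := by linarith
  obtain ⟨T, hT1, hTiso⟩ := exists_lewis_position_s15 hp0 hp2.le hμ hv
  set d := Module.finrank ℝ V with hd
  have hd0 : (0 : ℝ) < d := by exact_mod_cast Module.finrank_pos (R := ℝ) (M := V)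
  have hdn : (d : ℝ) ≤ n := by exact_mod_cast hn
  set w : ℝ := 1 + ∑ i, if v i = 0 then μ i else 0 with hw
  have hw1 : 1 ≤ w := by
    have : 0 ≤ ∑ i, if v i = 0 then μ i else 0 :=
      Finset.sum_nonneg fun i _ => by split_ifs <;> simp [hμ i]
    linarith
  have hw2 : w ≤ 2 := by
    have : ∑ i, (if v i = 0 then μ i else 0) ≤ ∑ i, μ i :=
      Finset.sum_le_sum fun i _ => by split_ifs <;> simp [hμ i]
    linarith
  have hw0 : 0 < w := by linarith
  have hTpos : ∀ i, v i ≠ 0 → 0 < ‖T (v i)‖ := fun i hi =>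
    norm_pos_iff.2 fun h => hi (by simpa using h)
  set α : ι → ℝ := fun i => if v i = 0 then 1 / w else ‖T (v i)‖ ^ p / w with hα
  have hα0 : ∀ i, v i ≠ 0 → α i = ‖T (v i)‖ ^ p / w := fun i hi => by simp [hα, hi]
  have hαpos : ∀ i, 0 < α i := by
    intro i
    by_cases hi : v i = 0
    · simp only [hα, hi, if_true]; positivity
    · rw [hα0 i hi]
      have := hTpos i hi
      positivity
  have hβ : ∀ i, v i ≠ 0 → (α i ^ (1 / p)) ^ 2 = ‖T (v i)‖ ^ 2 / w ^ (2 / p) := fun i hi => by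
    rw [hα0 i hi, div_rpow_inv_sq (hTpos i hi) hw0 hp0]
  refine ⟨α, hαpos, ?_, fun i => (√d / α i ^ (1 / p)) • T (v i),
    fun c => √d • ContinuousLinearMap.adjoint (T : V →L[ℝ] V) c, ?_, ?_, ?_, ?_⟩
  · have h : ∀ i, α i * μ i = ((if v i = 0 then μ i else 0) + μ i * ‖T (v i)‖ ^ p) / w := by
      intro i
      by_cases hi : v i = 0
      · simp only [hα, hi, if_true, map_zero, norm_zero, zero_rpow hp0.ne']; ring
      · simp only [hα, hi, if_false]; ring
    rw [Finset.sum_congr rfl fun i _ => h i, ← Finset.sum_div, Finset.sum_add_distrib, hT1,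
      div_eq_one_iff_eq hw0.ne', hw]
    ring
  · intro i
    by_cases hi : v i = 0
    · simp [hi]
    have hT := hTpos i hi
    rw [norm_smul, mul_pow, norm_eq_abs, sq_abs, div_pow, hβ i hi, sq_sqrt hd0.le]
    have h4 : w ^ (2 / p) ≤ 4 := by
      calc w ^ (2 / p) ≤ 2 ^ (2 / p) := by gcongr
        _ ≤ (2 : ℝ) ^ (2 : ℝ) := by
            refine rpow_le_rpow_of_exponent_le one_le_two ?_
            rw [div_le_iff₀ hp0]; linarith
        _ = 4 := by norm_num
    calc d / (‖T (v i)‖ ^ 2 / w ^ (2 / p)) * ‖T (v i)‖ ^ 2 = w ^ (2 / p) * d := by field_simp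
      _ ≤ 4 * n := by gcongr
  · intro c
    refine (hTiso c).trans ?_
    rw [mul_assoc, Finset.mul_sum]
    refine mul_le_mul_of_nonneg_left (Finset.sum_le_sum fun i _ => ?_) zero_le_two
    by_cases hi : v i = 0
    · simp [hi]
    have hT := hTpos i hi
    rw [real_inner_smul_left, mul_pow, div_pow, hβ i hi, sq_sqrt hd0.le, hα0 i hi,
      real_inner_comm c, rpow_sub hT, rpow_two]
    have hw3 : w ≤ w ^ (2 / p) := by
      calc w = w ^ (1 : ℝ) := (rpow_one _).symm
        _ ≤ w ^ (2 / p) := by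
          refine rpow_le_rpow_of_exponent_le hw1 ?_
          rw [le_div_iff₀ hp0]; linarith
    have hμi := hμ i
    have h1 : 1 ≤ w ^ (2 / p) / w := (one_le_div hw0).2 hw3
    have h2 : 0 ≤ d * (μ i * (‖T (v i)‖ ^ p / ‖T (v i)‖ ^ 2 * ⟪c, T (v i)⟫ ^ 2)) := by positivity
    calc d * (μ i * (‖T (v i)‖ ^ p / ‖T (v i)‖ ^ 2 * ⟪c, T (v i)⟫ ^ 2))
        ≤ d * (μ i * (‖T (v i)‖ ^ p / ‖T (v i)‖ ^ 2 * ⟪c, T (v i)⟫ ^ 2)) * (w ^ (2 / p) / w) :=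
          le_mul_of_one_le_right h2 h1
      _ = _ := by field_simp
  · intro c
    refine ⟨(√d)⁻¹ • ContinuousLinearMap.adjoint (T.symm : V →L[ℝ] V) c, ?_⟩
    simp only [map_smul, smul_smul]
    rw [mul_inv_cancel₀ (sqrt_pos.2 hd0).ne', one_smul]
    refine ext_inner_right ℝ fun y => ?_
    rw [ContinuousLinearMap.adjoint_inner_left, ContinuousLinearMap.adjoint_inner_left]
    simp
  · intro i _ c
    rw [inner_smul_right, ContinuousLinearMap.adjoint_inner_right, real_inner_smul_left]
    simp only [ContinuousLinearEquiv.coe_coe]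
    ring

theorem exists_density_net (hp : 1 < p) (hp2 : p < 2) (hn2 : 2 ≤ n) (hμ : ∀ i, 0 ≤ μ i)
    (hsum : ∑ i, μ i = 1) (hn : Module.finrank ℝ V ≤ n)
    (hv : ∀ c : V, (∀ i, 0 < μ i → ⟪c, v i⟫ = 0) → c = 0) :
    ∃ α : ι → ℝ, (∀ i, 0 < α i) ∧ ∑ i, α i * μ i = 1 ∧ ∀ t : ℝ, 0 < t → ∃ F : Finset V,
      (F.card : ℝ) ≤ exp (1000000 * n * log n * (8 / t) ^ (2 * p / (2 - p))) ∧
      ∀ c : V, ∑ i, α i * μ i * |⟪v i, c⟫ / α i ^ (1 / p)| ^ p ≤ 1 → ∃ c' ∈ F,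
        ∑ i, α i * μ i * (⟪v i, c'⟫ / α i ^ (1 / p) - ⟪v i, c⟫ / α i ^ (1 / p)) ^ 2 < t ^ 2 := by
  classical
  rcases subsingleton_or_nontrivial V with hV | hV
  · refine ⟨fun _ => 1, fun _ => one_pos, by simpa using hsum, fun t ht => ⟨{0}, ?_, fun c _ => ?_⟩⟩
    · rw [Finset.card_singleton, Nat.cast_one]
      have := log_natCast_nonneg n
      exact one_le_exp (by positivity)
    · refine ⟨0, by simp, ?_⟩
      rw [Subsingleton.elim c 0]
      simp only [sub_self]
      simpa using by positivity
  obtain ⟨α, hα, hαsum, φ, A, hφ, hiso, hA, hAφ⟩ :=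
    exists_density_coordinates hp hp2 hμ hsum hn hv
  have hν : ∀ i, 0 ≤ α i * μ i := fun i => mul_nonneg (hα i).le (hμ i)
  refine ⟨α, hα, hαsum, fun t ht => ?_⟩
  obtain ⟨F, hFcard, hF⟩ := exists_net_card_le hν hαsum hp hp2 hn2 hφ hiso ht
  refine ⟨F.image A, le_trans (by exact_mod_cast Finset.card_image_le) hFcard, fun c hc => ?_⟩
  obtain ⟨c, rfl⟩ := hA c
  obtain ⟨c', hc', h⟩ := hF c (by
    refine le_of_eq_of_le (Finset.sum_congr rfl fun i _ => ?_) hc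
    rcases eq_or_ne (μ i) 0 with hi | hi
    · simp [hi]
    · rw [hAφ i hi])
  refine ⟨A c', Finset.mem_image_of_mem A hc', ?_⟩
  refine lt_of_eq_of_lt (Finset.sum_congr rfl fun i _ => ?_) h
  rcases eq_or_ne (μ i) 0 with hi | hi
  · simp [hi]
  · rw [hAφ i hi, hAφ i hi, inner_sub_right]

end ChangeOfDensity

section Subspace

open Real
open scoped RealInnerProductSpace

lemma coverNum_le_card {β : Type*} {A : Set β} {d : β → β → ℝ} {t : ℝ} (c : Finset β)
    (h : ∀ y ∈ A, ∃ x ∈ c, d x y < t) : coverNum A d t ≤ c.card := by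
  refine Nat.sInf_le ⟨c, rfl, fun y hy => ?_⟩
  obtain ⟨x, hx, hxy⟩ := h y hy
  exact Set.mem_biUnion (t := fun x => {y | d x y < t}) hx hxy

/-- A subspace of functions, restricted to the support of `μ`, is the space of coefficient
functions `i ↦ ⟪v i, c⟫` of a family of vectors in a Euclidean space. -/
lemma exists_evaluation_vectors {ι : Type*} [Fintype ι] {μ : ι → ℝ}
    (X : Submodule ℝ (ι → ℝ)) :
    ∃ (E : Submodule ℝ (EuclideanSpace ℝ ι)) (v : ι → E),
      Module.finrank ℝ E ≤ Module.finrank ℝ X ∧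
      (∀ c : E, (∀ i, μ i ≠ 0 → ⟪c, v i⟫ = 0) → c = 0) ∧
      ∀ f ∈ X, ∃ c : E, ∀ i, μ i ≠ 0 → ⟪v i, c⟫ = f i := by
  classical
  let r : (ι → ℝ) →ₗ[ℝ] EuclideanSpace ℝ ι :=
    (WithLp.linearEquiv 2 ℝ (ι → ℝ)).symm.toLinearMap ∘ₗ
      LinearMap.pi fun i => if μ i = 0 then 0 else LinearMap.proj i
  have hr : ∀ f i, r f i = if μ i = 0 then 0 else f i := fun f i => by
    by_cases h : μ i = 0 <;> simp [r, h]
  let E := X.map r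
  let v : ι → E := fun i => E.orthogonalProjectionOnto (EuclideanSpace.single i (1 : ℝ))
  have hvE : ∀ i (c : E), ⟪v i, c⟫ = (c : EuclideanSpace ℝ ι) i := fun i c => by
    rw [Submodule.inner_orthogonalProjectionOnto_eq_of_mem_right]
    exact (EuclideanSpace.inner_single_left i 1 (c : EuclideanSpace ℝ ι)).trans (by simp)
  refine ⟨E, v, Submodule.finrank_map_le r X, fun c hc => ?_, fun f hf => ?_⟩
  · ext i
    obtain ⟨f, -, hf⟩ := c.2
    by_cases hi : μ i = 0
    · rw [← hf, hr]; simp [hi]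
    · have := hc i hi
      rw [real_inner_comm, hvE] at this
      simpa using this
  · refine ⟨⟨r f, Submodule.mem_map_of_mem hf⟩, fun i hi => ?_⟩
    rw [hvE, hr, if_neg hi]

end Subspace

/-- Proposition 2.1 (i) and (ii), case `1 < p < 2`: given an `n`-dimensional subspace `X`
of `L_p(N̄, μ)` (`μ` a probability measure on `{1,…,N}`, `2 ≤ n ≤ N`), there is a density
`α` on `(N̄, μ)` such that, with `X̃ = {x/α^{1/p} : x ∈ X}` and `B(X̃_p)` the unit ball of
`X̃` in `L_p(α dμ)`:
for every `t` with `1 ≤ t ≤ 2n`,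
`log E(B(X̃_p), ‖·‖_{L_2(α dμ)}, t) ≤ C (p-1)^{-1} (C/t)^{2p/(2-p)} n log n`,
where `C` is an absolute constant. -/
theorem entropy_density_L2_one_lt_p_lt_two :
    ∃ C : ℝ, 0 < C ∧
      ∀ (p : ℝ), 1 < p → p < 2 →
      ∀ (n N : ℕ), 2 ≤ n → n ≤ N →
      ∀ (μ : Fin N → ℝ), (∀ i, 0 ≤ μ i) → ∑ i, μ i = 1 →
      ∀ (X : Submodule ℝ (Fin N → ℝ)), Module.finrank ℝ X = n →
      ∃ α : Fin N → ℝ, (∀ i, 0 < α i) ∧ ∑ i, α i * μ i = 1 ∧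
        ∀ t : ℝ, 1 ≤ t → t ≤ 2 * n →
          Real.log (coverNum
              { g ∈ (fun (f : Fin N → ℝ) i => f i / α i ^ (1 / p)) '' (X : Set (Fin N → ℝ)) |
                ∑ i, α i * μ i * |g i| ^ p ≤ 1 }
              (fun f g => Real.sqrt (∑ i, α i * μ i * (f i - g i) ^ 2)) t) ≤
            C * (p - 1)⁻¹ * (C / t) ^ (2 * p / (2 - p)) * n * Real.log n := by
  classical
  refine ⟨1000000, by norm_num, ?_⟩
  intro p hp hp2 n N hn _ μ hμ hsum X hX
  obtain ⟨E, v, hE, hv, hXE⟩ := exists_evaluation_vectors (μ := μ) X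
  obtain ⟨α, hα, hαsum, hnet⟩ := exists_density_net hp hp2 hn hμ hsum (hE.trans_eq hX)
    (fun c hc => hv c fun i hi => hc i ((hμ i).lt_of_ne' hi))
  refine ⟨α, hα, hαsum, fun t ht _ => ?_⟩
  have ht0 : 0 < t := by linarith
  have hlog : 0 ≤ Real.log n := Real.log_natCast_nonneg n
  have hp' : 0 < 2 - p := by linarith
  obtain ⟨F, hFcard, hF⟩ := hnet t ht0
  have hcover := coverNum_le_card
    (A := { g ∈ (fun (f : Fin N → ℝ) i => f i / α i ^ (1 / p)) '' (X : Set (Fin N → ℝ)) |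
      ∑ i, α i * μ i * |g i| ^ p ≤ 1 })
    (d := fun f g => Real.sqrt (∑ i, α i * μ i * (f i - g i) ^ 2)) (t := t)
    (F.image fun c i => inner ℝ (v i) c / α i ^ (1 / p)) (by
      rintro _ ⟨⟨f, hf, rfl⟩, hball⟩
      obtain ⟨c, hc⟩ := hXE f hf
      obtain ⟨c', hc', h⟩ := hF c (by
        refine le_of_eq_of_le (Finset.sum_congr rfl fun i _ => ?_) hball
        rcases eq_or_ne (μ i) 0 with hi | hi
        · simp [hi]
        · rw [hc i hi])
      refine ⟨_, Finset.mem_image_of_mem _ hc', ?_⟩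
      rw [Real.sqrt_lt' ht0]
      refine lt_of_eq_of_lt (Finset.sum_congr rfl fun i _ => ?_) h
      rcases eq_or_ne (μ i) 0 with hi | hi
      · simp [hi]
      · rw [hc i hi])
  set m := coverNum
    { g ∈ (fun (f : Fin N → ℝ) i => f i / α i ^ (1 / p)) '' (X : Set (Fin N → ℝ)) |
      ∑ i, α i * μ i * |g i| ^ p ≤ 1 }
    (fun f g => Real.sqrt (∑ i, α i * μ i * (f i - g i) ^ 2)) t
  have hm : (m : ℝ) ≤ Real.exp (1000000 * n * Real.log n * (8 / t) ^ (2 * p / (2 - p))) :=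
    le_trans (by exact_mod_cast hcover.trans Finset.card_image_le) hFcard
  have hlogm : Real.log m ≤ 1000000 * n * Real.log n * (8 / t) ^ (2 * p / (2 - p)) := by
    rcases Nat.eq_zero_or_pos m with h0 | h0
    · rw [h0, Nat.cast_zero, Real.log_zero]; positivity
    · exact (Real.log_le_iff_le_exp (by exact_mod_cast h0)).2 hm
  have hpinv : 1 ≤ (p - 1)⁻¹ := (one_le_inv₀ (by linarith)).2 (by linarith)
  have hpow : (8 / t) ^ (2 * p / (2 - p)) ≤ (1000000 / t) ^ (2 * p / (2 - p)) := by
    gcongr; norm_num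
  calc Real.log m ≤ 1000000 * n * Real.log n * (8 / t) ^ (2 * p / (2 - p)) := hlogm
    _ ≤ 1000000 * n * Real.log n * (1000000 / t) ^ (2 * p / (2 - p)) := by gcongr
    _ ≤ 1000000 * n * Real.log n * (1000000 / t) ^ (2 * p / (2 - p)) * (p - 1)⁻¹ :=
        le_mul_of_one_le_right (by positivity) hpinv
    _ = 1000000 * (p - 1)⁻¹ * (1000000 / t) ^ (2 * p / (2 - p)) * n * Real.log n := by ring
end
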